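/- In the constrained setting, assume that for every x ∈ 𝓝^∞ and every j = 0,…,m the function ω ↦ f_j(x(ω),ω) is finite a.s. and belongs to 𝓤₀. Then for every y ∈ 𝓨 there exists v ∈ 𝓝^⊥ such that Ef*(v,y) = φ̃*(y); consequently φ*(y) = φ̃*(y) = min_{v∈𝓝^⊥} Ef*(v,y) for every y ∈ 𝓨. -/

import Mathlib

open MeasureTheory
open scoped ENNReal

noncomputable section

/-- The positive part of an extended real number, as an extended nonnegative real. -/
def epos (a : EReal) : ℝ≥0∞ := if a = ⊤ then ⊤ else ENNReal.ofReal a.toReal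

/-- Expectation of an extended-real-valued function: it equals `+∞` unless the positive
part is integrable, in which case it is the usual (possibly `-∞`) integral. -/
def EE {Ω : Type} [MeasurableSpace Ω] (P : Measure Ω) (φ : Ω → EReal) : EReal :=
  if ∫⁻ ω, epos (φ ω) ∂P = ⊤ then ⊤
  else ((∫⁻ ω, epos (φ ω) ∂P : ℝ≥0∞) : EReal) - ((∫⁻ ω, epos (-(φ ω)) ∂P : ℝ≥0∞) : EReal)

/-- `ℝ^n` viewed as `ℝ^{n_0} × ⋯ × ℝ^{n_T}`. -/
abbrev Vec {T : ℕ} (nt : Fin (T+1) → ℕ) : Type := (t : Fin (T+1)) → Fin (nt t) → ℝ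

/-- `x·v = Σ_t x_t·v_t`. -/
def dotN {T : ℕ} (nt : Fin (T+1) → ℕ) (a b : Vec nt) : ℝ := ∑ t, ∑ i, a t i * b t i

/-- The scalar product on `ℝ^m`. -/
def dotM {m : ℕ} (a b : Fin m → ℝ) : ℝ := ∑ j, a j * b j

variable {Ω : Type} [MeasurableSpace Ω] {T : ℕ} {nt : Fin (T+1) → ℕ} {m : ℕ}

/-- The space `𝓝` of adapted strategies. -/
def Nspace (nt : Fin (T+1) → ℕ) (ℱ : Fin (T+1) → MeasurableSpace Ω) :
    Set (Ω → Vec nt) := {x | ∀ t, Measurable[ℱ t] (fun ω => x ω t)}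

/-- The space `𝓝^∞` of essentially bounded adapted strategies. -/
def NspaceInf (nt : Fin (T+1) → ℕ) (ℱ : Fin (T+1) → MeasurableSpace Ω)
    (P : Measure Ω) : Set (Ω → Vec nt) :=
  {x | x ∈ Nspace nt ℱ ∧ ∃ M : ℝ, ∀ᵐ ω ∂P, ‖x ω‖ ≤ M}

/-- The annihilator `𝓝^⊥` of `𝓝^∞` in `L¹`. -/
def Nperp (nt : Fin (T+1) → ℕ) (ℱ : Fin (T+1) → MeasurableSpace Ω)
    (P : Measure Ω) : Set (Ω → Vec nt) :=
  {v | Measurable v ∧ Integrable v P ∧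
    ∀ x ∈ NspaceInf nt ℱ P, ∫ ω, dotN nt (x ω) (v ω) ∂P = 0}

/-- `Ef(x,u)`. -/
def intF (P : Measure Ω) (f : Vec nt → (Fin m → ℝ) → Ω → EReal)
    (x : Ω → Vec nt) (u : Ω → Fin m → ℝ) : EReal :=
  EE P (fun ω => f (x ω) (u ω) ω)

/-- The bilinear pairing `⟨u,y⟩ = E(u·y)`. -/
def pairing (P : Measure Ω) (u y : Ω → Fin m → ℝ) : ℝ := ∫ ω, dotM (u ω) (y ω) ∂P

/-- The value function `φ(u) = inf_{x∈𝓝} Ef(x,u)`. -/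
def valueFn (P : Measure Ω) (f : Vec nt → (Fin m → ℝ) → Ω → EReal)
    (ℱ : Fin (T+1) → MeasurableSpace Ω) (u : Ω → Fin m → ℝ) : EReal :=
  ⨅ x ∈ Nspace nt ℱ, intF P f x u

/-- The auxiliary value function `φ̃(u) = inf_{x∈𝓝^∞} Ef(x,u)`. -/
def valueFnInf (P : Measure Ω) (f : Vec nt → (Fin m → ℝ) → Ω → EReal)
    (ℱ : Fin (T+1) → MeasurableSpace Ω) (u : Ω → Fin m → ℝ) : EReal :=
  ⨅ x ∈ NspaceInf nt ℱ P, intF P f x u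

/-- The conjugate on `𝓨` of a function `g` on `𝓤`. -/
def conj (P : Measure Ω) (𝓤 : Set (Ω → Fin m → ℝ)) (g : (Ω → Fin m → ℝ) → EReal)
    (y : Ω → Fin m → ℝ) : EReal :=
  ⨆ u ∈ 𝓤, (((pairing P u y : ℝ) : EReal) - g u)

/-- The Lagrangian integrand `l(x,y,ω) = inf_u {f(x,u,ω) − u·y}`. -/
def lagr (f : Vec nt → (Fin m → ℝ) → Ω → EReal) (x : Vec nt) (y : Fin m → ℝ)
    (ω : Ω) : EReal :=
  ⨅ u : Fin m → ℝ, (f x u ω - ((dotM u y : ℝ) : EReal))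

/-- `El(x,y)`. -/
def intL (P : Measure Ω) (f : Vec nt → (Fin m → ℝ) → Ω → EReal)
    (x : Ω → Vec nt) (y : Ω → Fin m → ℝ) : EReal :=
  EE P (fun ω => lagr f (x ω) (y ω) ω)

/-- The pointwise conjugate `f*(v,y,ω)`. -/
def fconj (f : Vec nt → (Fin m → ℝ) → Ω → EReal) (v : Vec nt) (y : Fin m → ℝ)
    (ω : Ω) : EReal :=
  ⨆ x : Vec nt, ⨆ u : Fin m → ℝ, (((dotN nt x v + dotM u y : ℝ) : EReal) - f x u ω)

/-- `Ef*(v,y)`. -/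
def intFconj (P : Measure Ω) (f : Vec nt → (Fin m → ℝ) → Ω → EReal)
    (v : Ω → Vec nt) (y : Ω → Fin m → ℝ) : EReal :=
  EE P (fun ω => fconj f (v ω) (y ω) ω)

/-- `l̲(x,y,ω) = sup_v {x·v − f*(v,y,ω)}`. -/
def lagrLow (f : Vec nt → (Fin m → ℝ) → Ω → EReal) (x : Vec nt) (y : Fin m → ℝ)
    (ω : Ω) : EReal :=
  ⨆ v : Vec nt, (((dotN nt x v : ℝ) : EReal) - fconj f v y ω)

/-- `El̲(x,y)`. -/
def intLlow (P : Measure Ω) (f : Vec nt → (Fin m → ℝ) → Ω → EReal)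
    (x : Ω → Vec nt) (y : Ω → Fin m → ℝ) : EReal :=
  EE P (fun ω => lagrLow f (x ω) (y ω) ω)

/-- `dom₁ Ef = {x ∈ 𝓝 : Ef(x,u) < +∞ for some u ∈ 𝓤}`. -/
def dom1intF (P : Measure Ω) (f : Vec nt → (Fin m → ℝ) → Ω → EReal)
    (ℱ : Fin (T+1) → MeasurableSpace Ω) (𝓤 : Set (Ω → Fin m → ℝ)) :
    Set (Ω → Vec nt) :=
  {x | x ∈ Nspace nt ℱ ∧ ∃ u ∈ 𝓤, intF P f x u < ⊤}

/-- The algebraic closure of a convex set in a real vector space. -/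
def acl {A : Type} [AddCommGroup A] [Module ℝ A] (C : Set A) : Set A :=
  {x | ∃ z ∈ C, ∀ lam : ℝ, 0 < lam → lam ≤ 1 → ((1 - lam) • x + lam • z) ∈ C}

/-- Decomposability of a set of measurable functions. -/
def Decomposable (P : Measure Ω) (𝓤 : Set (Ω → Fin m → ℝ)) : Prop :=
  ∀ A : Set Ω, MeasurableSet A → ∀ u ∈ 𝓤, ∀ u' : Ω → Fin m → ℝ,
    Measurable u' → (∃ M : ℝ, ∀ᵐ ω ∂P, ‖u' ω‖ ≤ M) →
    (fun ω => A.indicator u ω + Aᶜ.indicator u' ω) ∈ 𝓤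

end

open scoped Classical in
/-- The integrand of the constrained problem: `f(x,u,ω) = f₀(x,ω)` if
`f_j(x,ω) + u_j ≤ 0` for all `j = 1,…,m`, and `+∞` otherwise. -/
noncomputable def fCon {Ω : Type} {T : ℕ} {nt : Fin (T+1) → ℕ} {m : ℕ}
    (f0 : Vec nt → Ω → EReal) (fj : Fin m → Vec nt → Ω → EReal) :
    Vec nt → (Fin m → ℝ) → Ω → EReal :=
  fun x u ω => if ∀ j, fj j x ω + ((u j : ℝ) : EReal) ≤ 0 then f0 x ω else ⊤

/-- Decomposability of a set of real-valued measurable functions. -/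
def DecomposableR {Ω : Type} [MeasurableSpace Ω] (P : Measure Ω)
    (S : Set (Ω → ℝ)) : Prop :=
  ∀ A : Set Ω, MeasurableSet A → ∀ u ∈ S, ∀ u' : Ω → ℝ,
    Measurable u' → (∃ M : ℝ, ∀ᵐ ω ∂P, |u' ω| ≤ M) →
    (fun ω => A.indicator u ω + Aᶜ.indicator u' ω) ∈ S

lemma aux_mct {Ω : Type} [MeasurableSpace Ω] {P : Measure Ω} (g : ℕ → Ω → ℝ)
    (hg : ∀ k, Integrable (g k) P) (hmono : ∀ᵐ ω ∂P, Monotone (fun k => g k ω)) (C : ℝ)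
    (hC : ∀ k, ∫ ω, g k ω ∂P ≤ C) :
    ∃ G : Ω → ℝ, Integrable G P ∧ ∫ ω, G ω ∂P ≤ C ∧ ∀ᵐ ω ∂P, ∀ k, g k ω ≤ G ω := by
  set h : ℕ → Ω → ℝ≥0∞ := fun k ω => ENNReal.ofReal (g k ω - g 0 ω) with hh
  have hm : ∀ k, AEMeasurable (h k) P := fun k =>
    ((hg k).sub (hg 0)).aestronglyMeasurable.aemeasurable.ennreal_ofReal
  have hhm : ∀ᵐ ω ∂P, Monotone (fun k => h k ω) := by
    filter_upwards [hmono] with ω hω i j hij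
    exact ENNReal.ofReal_le_ofReal (sub_le_sub_right (hω hij) _)
  have h1 : ∀ k, ∫⁻ ω, h k ω ∂P ≤ ENNReal.ofReal (C - ∫ ω, g 0 ω ∂P) := by
    intro k
    have : ∫⁻ ω, h k ω ∂P = ENNReal.ofReal (∫ ω, (g k ω - g 0 ω) ∂P) := by
      symm
      refine ofReal_integral_eq_lintegral_ofReal ((hg k).sub (hg 0)) ?_
      · filter_upwards [hmono] with ω hω
        exact sub_nonneg.2 (hω (Nat.zero_le k))
    rw [this, integral_sub (hg k) (hg 0)]
    exact ENNReal.ofReal_le_ofReal (sub_le_sub_right (hC k) _)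
  have h2 : ∫⁻ ω, ⨆ k, h k ω ∂P ≤ ENNReal.ofReal (C - ∫ ω, g 0 ω ∂P) := by
    rw [lintegral_iSup' hm hhm]
    exact iSup_le h1
  have hmS : AEMeasurable (fun ω => ⨆ k, h k ω) P := AEMeasurable.iSup hm
  have h3 : ∫⁻ ω, ⨆ k, h k ω ∂P ≠ ⊤ := ne_top_of_le_ne_top ENNReal.ofReal_ne_top h2
  have hint := integrable_toReal_of_lintegral_ne_top hmS h3
  refine ⟨fun ω => g 0 ω + (⨆ k, h k ω).toReal, (hg 0).add hint, ?_, ?_⟩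
  · rw [integral_add (hg 0) hint, integral_toReal hmS (ae_lt_top' hmS h3)]
    have : (∫⁻ ω, ⨆ k, h k ω ∂P).toReal ≤ C - ∫ ω, g 0 ω ∂P := by
      refine ENNReal.toReal_le_of_le_ofReal ?_ h2
      linarith [hC 0]
    linarith
  · filter_upwards [ae_lt_top' hmS h3] with ω hω k
    have : g k ω - g 0 ω ≤ (⨆ k, h k ω).toReal := by
      rw [← ENNReal.ofReal_le_iff_le_toReal hω.ne]
      exact le_iSup (fun k => h k ω) k
    linarith

lemma epos_eq : epos = EReal.toENNReal := rfl

lemma EE_mono {Ω : Type} [MeasurableSpace Ω] {P : Measure Ω} {a b : Ω → EReal}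
    (h : ∀ᵐ ω ∂P, a ω ≤ b ω) : EE P a ≤ EE P b := by
  have h1 : ∫⁻ ω, epos (a ω) ∂P ≤ ∫⁻ ω, epos (b ω) ∂P := by
    refine lintegral_mono_ae ?_
    filter_upwards [h] with ω hω
    exact EReal.toENNReal_le_toENNReal hω
  have h2 : ∫⁻ ω, epos (-b ω) ∂P ≤ ∫⁻ ω, epos (-a ω) ∂P := by
    refine lintegral_mono_ae ?_
    filter_upwards [h] with ω hω
    exact EReal.toENNReal_le_toENNReal (EReal.neg_le_neg_iff.2 hω)
  unfold EE
  by_cases hb : ∫⁻ ω, epos (b ω) ∂P = ⊤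
  · simp [hb]
  · have ha : ∫⁻ ω, epos (a ω) ∂P ≠ ⊤ := ne_top_of_le_ne_top hb h1
    rw [if_neg ha, if_neg hb]
    exact EReal.sub_le_sub (by exact_mod_cast h1) (by exact_mod_cast h2)

lemma EE_coe {Ω : Type} [MeasurableSpace Ω] {P : Measure Ω} {g : Ω → ℝ}
    (h : Integrable g P) : EE P (fun ω => ((g ω : ℝ) : EReal)) = ((∫ ω, g ω ∂P : ℝ) : EReal) := by
  have e1 : ∀ r : ℝ, epos (r : EReal) = ENNReal.ofReal r := fun r => by
    simp [epos_eq]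
  have e2 : ∀ r : ℝ, epos (-(r : EReal)) = ENNReal.ofReal (-r) := fun r => by
    rw [← e1]; rfl
  have h1 : ∫⁻ ω, ENNReal.ofReal (g ω) ∂P ≠ ⊤ := (h.lintegral_lt_top).ne
  have h2 : ∫⁻ ω, ENNReal.ofReal (-g ω) ∂P ≠ ⊤ := (h.neg.lintegral_lt_top).ne
  unfold EE
  simp only [e1, e2]
  rw [if_neg h1, integral_eq_lintegral_pos_part_sub_lintegral_neg_part h]
  lift ∫⁻ ω, ENNReal.ofReal (g ω) ∂P to NNReal using h1 with p hp
  lift ∫⁻ ω, ENNReal.ofReal (-g ω) ∂P to NNReal using h2 with q hq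
  rfl

lemma EE_real {Ω : Type} [MeasurableSpace Ω] {P : Measure Ω} {a : Ω → EReal}
    (hm : AEMeasurable a P) (hp : ∫⁻ ω, epos (a ω) ∂P ≠ ⊤) {g : Ω → ℝ} (hg : Integrable g P)
    (hle : ∀ᵐ ω ∂P, ((g ω : ℝ) : EReal) ≤ a ω) :
    ∃ A : Ω → ℝ, Integrable A P ∧ (∀ᵐ ω ∂P, a ω = ((A ω : ℝ) : EReal)) ∧
      EE P a = ((∫ ω, A ω ∂P : ℝ) : EReal) := by
  have hme : AEMeasurable (fun ω => epos (a ω)) P := hm.ereal_toENNReal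
  have hI := integrable_toReal_of_lintegral_ne_top hme hp
  have hae : ∀ᵐ ω ∂P, a ω = (((a ω).toReal : ℝ) : EReal) := by
    filter_upwards [hle, ae_lt_top' hme hp] with ω h1 h2
    rw [EReal.coe_toReal]
    · intro h; simp [h, epos] at h2
    · intro h; simp [h] at h1
  have hA : Integrable (fun ω => (a ω).toReal) P := by
    refine Integrable.mono' (hI.add hg.abs) hm.ereal_toReal.aestronglyMeasurable ?_
    filter_upwards [hle, hae] with ω h1 h2
    rw [h2] at h1 ⊢
    have h1' : g ω ≤ (a ω).toReal := by exact_mod_cast h1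
    simp only [Pi.add_apply, Real.norm_eq_abs, EReal.toReal_coe]
    have e1 : (epos (a ω)).toReal = max (a ω).toReal 0 := by
      rw [h2]; simp [epos_eq, ENNReal.toReal_ofReal']
    rw [e1, abs_le]
    constructor
    · have := neg_abs_le (g ω); have := le_max_right (a ω).toReal 0
      linarith
    · have := abs_nonneg (g ω); have := le_max_left (a ω).toReal 0
      linarith
  refine ⟨_, hA, hae, ?_⟩
  rw [← EE_coe hA]
  refine le_antisymm (EE_mono ?_) (EE_mono ?_)
  · filter_upwards [hae] with ω h using h.le
  · filter_upwards [hae] with ω h using h.ge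

lemma aux_HB {E : Type} [AddCommGroup E] [Module ℝ E] (N : Submodule ℝ E) (p : E → ℝ)
    (hp : ∀ (a b : ℝ) (x y : E), 0 < a → 0 < b → a + b = 1 →
      p (a • x + b • y) ≤ a * p x + b * p y) (α : ℝ) (hα : ∀ x ∈ N, α ≤ p x) :
    ∃ l : E →ₗ[ℝ] ℝ, (∀ x ∈ N, l x = 0) ∧ ∀ x, l x ≤ p x - α := by
  have h0 : α ≤ p 0 := hα 0 N.zero_mem
  set Q : E → Set.Ioi (0:ℝ) → ℝ := fun x t => (p ((t:ℝ) • x) - α) / t with hQ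
  have key : ∀ x (t s : Set.Ioi (0:ℝ)), -((p (-(s:ℝ) • x) - α) / s) ≤ Q x t := by
    rintro x ⟨t, ht⟩ ⟨s, hs⟩
    have ht' : 0 < t := ht
    have hs' : 0 < s := hs
    have := hp (s/(s+t)) (t/(s+t)) (t • x) (-s • x) (by positivity) (by positivity) (by field_simp)
    have e : (s/(s+t)) • t • x + (t/(s+t)) • (-s • x) = 0 := by
      rw [smul_smul, smul_smul, ← add_smul]
      convert zero_smul ℝ x
      field_simp; ring
    rw [e] at this
    have h2 : 0 ≤ s/(s+t) * (p (t • x) - α) + t/(s+t) * (p (-s • x) - α) := by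
      have e3 : s/(s+t) * (p (t • x) - α) + t/(s+t) * (p (-s • x) - α)
        = s/(s+t) * p (t • x) + t/(s+t) * p (-s • x) - α := by field_simp; ring
      rw [e3]; linarith
    have h3 : s/(s+t) * (p (t • x) - α) + t/(s+t) * (p (-s • x) - α)
      = (s * t/(s+t)) * ((p (t • x) - α) / t + (p (-s • x) - α) / s) := by
      field_simp
    rw [h3] at h2
    have h4 := nonneg_of_mul_nonneg_right h2 (by positivity)
    simp only [hQ]
    linarith
  have hbdd : ∀ x, BddBelow (Set.range (Q x)) := fun x =>
    ⟨-((p (-(1:ℝ) • x) - α) / 1), by rintro _ ⟨t, rfl⟩; exact key x t ⟨1, by simp⟩⟩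
  have : Nonempty (Set.Ioi (0:ℝ)) := ⟨⟨1, by simp⟩⟩
  set M : E → ℝ := fun x => ⨅ t, Q x t with hM
  have hMle : ∀ x (t : ℝ) (ht : 0 < t), M x ≤ (p (t • x) - α) / t := fun x t ht =>
    ciInf_le (hbdd x) ⟨t, ht⟩
  have hhom1 : ∀ c : ℝ, 0 < c → ∀ x, c * M x ≤ M (c • x) := by
    intro c hc x
    refine le_ciInf ?_
    rintro ⟨t, ht⟩
    have ht' : 0 < t := ht
    have := hMle x (t * c) (by positivity)
    rw [← smul_smul] at this
    simp only [hQ]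
    calc c * M x ≤ c * ((p (t • c • x) - α) / (t * c)) := by gcongr
      _ = _ := by field_simp
  obtain ⟨l, hl1, hl2⟩ := exists_extension_of_le_sublinear (⟨N, 0⟩ : E →ₗ.[ℝ] ℝ) M
    (by
      intro c hc x
      refine le_antisymm ?_ (hhom1 c hc x)
      have := hhom1 c⁻¹ (by positivity) (c • x)
      rw [smul_smul, inv_mul_cancel₀ hc.ne', one_smul, inv_mul_le_iff₀ hc] at this
      exact this)
    (by
      intro x y
      have : ∀ t s, M (x + y) ≤ Q x t + Q y s := by
        rintro ⟨t, ht⟩ ⟨s, hs⟩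
        have ht' : 0 < t := ht
        have hs' : 0 < s := hs
        refine (hMle (x+y) (t * s/(t+s)) (by positivity)).trans ?_
        have := hp (s/(s+t)) (t/(s+t)) (t • x) (s • y) (by positivity) (by positivity)
          (by field_simp)
        have e : (s/(s+t)) • t • x + (t/(s+t)) • (s • y) = (t * s/(t+s)) • (x+y) := by
          rw [smul_smul, smul_smul, smul_add]
          congr 2
          · field_simp; ring
          · field_simp; ring
        rw [e] at this
        simp only [hQ]
        rw [div_le_iff₀ (by positivity)]
        have e2 : ((p (t • x) - α) / t + (p (s • y) - α) / s) * (t * s/(t+s)) =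
          s/(s+t) * p (t • x) + t/(s+t) * p (s • y) - α := by
          field_simp; ring
        rw [e2]; linarith
      have h1 : ∀ s, M (x+y) - Q y s ≤ M x := fun s =>
        le_ciInf fun t => by linarith [this t s]
      have h2 : M (x+y) - M x ≤ M y := le_ciInf fun s => by linarith [h1 s]
      linarith)
    (by
      rintro ⟨x, hx⟩
      refine le_ciInf ?_
      rintro ⟨t, ht⟩
      have ht' : 0 < t := ht
      have := hα (t • x) (N.smul_mem t hx)
      simp only [hQ]
      change (0:ℝ) ≤ _
      exact div_nonneg (by linarith) ht'.le)
  refine ⟨l, fun x hx => hl1 ⟨x, hx⟩, fun x => (hl2 x).trans ?_⟩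
  have := hMle x 1 one_pos
  simpa using this

lemma dotN_integrable {Ω : Type} [mΩ : MeasurableSpace Ω] {P : Measure Ω}
    {T : ℕ} {nt : Fin (T+1) → ℕ} {x v : Ω → Vec nt} (hx : Measurable x)
    (hb : ∃ M : ℝ, ∀ᵐ ω ∂P, ‖x ω‖ ≤ M) (hv : Integrable v P) :
    Integrable (fun ω => dotN nt (x ω) (v ω)) P := by
  obtain ⟨M, hM⟩ := hb
  unfold dotN
  refine integrable_finsetSum _ fun t _ => integrable_finsetSum _ fun i _ => ?_
  have hvi : Integrable (fun ω => v ω t i) P := (hv.eval t).eval i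
  refine hvi.bdd_mul (c := M) ?_ ?_
  · exact ((measurable_pi_apply i).comp ((measurable_pi_apply t).comp hx)).aestronglyMeasurable
  · filter_upwards [hM] with ω h
    exact ((norm_le_pi_norm _ i).trans (norm_le_pi_norm (x ω) t)).trans h

lemma dotN_measurable {Ω : Type} [mΩ : MeasurableSpace Ω]
    {T : ℕ} {nt : Fin (T+1) → ℕ} {x v : Ω → Vec nt} (hx : Measurable x) (hv : Measurable v) :
    Measurable (fun ω => dotN nt (x ω) (v ω)) := by
  unfold dotN
  fun_prop

lemma Nspace_measurable {Ω : Type} [mΩ : MeasurableSpace Ω]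
    {T : ℕ} {ℱ : Fin (T+1) → MeasurableSpace Ω} (hℱ_le : ∀ t, ℱ t ≤ mΩ)
    {nt : Fin (T+1) → ℕ} {x : Ω → Vec nt} (hx : x ∈ Nspace nt ℱ) : Measurable x :=
  measurable_pi_lambda _ fun t => (hx t).mono (hℱ_le t) le_rfl

lemma aux_perp {Ω : Type} [mΩ : MeasurableSpace Ω] (P : Measure Ω) [IsProbabilityMeasure P]
    {T : ℕ} (ℱ : Fin (T+1) → MeasurableSpace Ω)
    (hℱ_le : ∀ t, ℱ t ≤ mΩ) (hℱ_mono : Monotone ℱ)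
    (nt : Fin (T+1) → ℕ) (v : Ω → Vec nt) (hv : v ∈ Nperp nt ℱ P) (k : ℕ) :
    ∀ x ∈ Nspace nt ℱ, (∀ t : Fin (T+1), t.val + k < T + 1 → ∀ ω, x ω t = 0) →
    ∀ w : Ω → ℝ, Integrable w P → (∀ᵐ ω ∂P, dotN nt (x ω) (v ω) ≤ w ω) →
      Integrable (fun ω => dotN nt (x ω) (v ω)) P ∧ ∫ ω, dotN nt (x ω) (v ω) ∂P = 0 := by
  obtain ⟨hvm, hvi, hv0⟩ := hv
  induction k with
  | zero =>
    intro x hx h0 w hw hle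
    have : ∀ ω, dotN nt (x ω) (v ω) = 0 := by
      intro ω
      unfold dotN
      refine Finset.sum_eq_zero fun t _ => Finset.sum_eq_zero fun i _ => ?_
      rw [h0 t (by have := t.2; omega) ω]; simp
    simp [this]
  | succ k ih =>
    intro x hx h0 w hw hle
    by_cases hk : T < k
    · exact ih x hx (fun t ht => by omega) w hw hle
    push Not at hk
    set t0 : Fin (T+1) := ⟨T - k, by omega⟩ with ht0
    have hlt : ∀ t, t < t0 → ∀ ω, x ω t = 0 := by
      intro t ht
      apply h0
      have : t.val < T - k := ht
      omega
    set A : ℕ → Set Ω := fun K => {ω | ‖x ω t0‖ ≤ K} with hA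
    have hAm : ∀ K, MeasurableSet[ℱ t0] (A K) := fun K =>
      (measurable_norm.comp (hx t0)) measurableSet_Iic
    have hAm' : ∀ K, MeasurableSet (A K) := fun K => hℱ_le _ _ (hAm K)
    set h : Ω → ℝ := fun ω => dotN nt (x ω) (v ω) with hh
    have hhm : Measurable h := dotN_measurable (Nspace_measurable hℱ_le hx) hvm
    classical
    have step : ∀ K, Integrable ((A K).indicator h) P ∧ ∫ ω, (A K).indicator h ω ∂P = 0 := by
      intro K
      set b : Ω → Vec nt := fun ω t => if t = t0 then (A K).indicator (fun ω => x ω t) ω else 0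
        with hb
      set r : Ω → Vec nt := fun ω t => if t = t0 then 0 else (A K).indicator (fun ω => x ω t) ω
        with hr
      have hbN : b ∈ Nspace nt ℱ := by
        intro t
        by_cases ht : t = t0
        · subst ht
          simp only [hb, if_true]
          exact Measurable.indicator (hx _) (hAm K)
        · simp only [hb, if_neg ht]
          exact measurable_const
      have hrN : r ∈ Nspace nt ℱ := by
        intro t
        by_cases ht : t = t0
        · subst ht
          simp only [hr, if_true]
          exact measurable_const
        · simp only [hr, if_neg ht]
          rcases lt_or_gt_of_ne ht with h1 | h1
          · have : (fun ω => (A K).indicator (fun ω => x ω t) ω) = fun _ => 0 := by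
              funext ω
              simp [Set.indicator, hlt t h1 ω]
            rw [this]
            exact measurable_const
          · exact Measurable.indicator (hx _) (hℱ_mono h1.le _ (hAm K))
      have hbb : ∃ M : ℝ, ∀ᵐ ω ∂P, ‖b ω‖ ≤ M := by
        refine ⟨K, Filter.Eventually.of_forall fun ω => ?_⟩
        rw [pi_norm_le_iff_of_nonneg (Nat.cast_nonneg K)]
        intro t
        by_cases ht : t = t0
        · subst ht
          simp only [hb, if_true]
          by_cases hω : ω ∈ A K
          · rw [Set.indicator_of_mem hω]; exact hω
          · rw [Set.indicator_of_notMem hω]; simp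
        · simp [hb, if_neg ht]
      have hbI := dotN_integrable (Nspace_measurable hℱ_le hbN) hbb hvi
      have hb0 := hv0 b ⟨hbN, hbb⟩
      have hsum : ∀ ω, dotN nt (b ω) (v ω) + dotN nt (r ω) (v ω) = (A K).indicator h ω := by
        intro ω
        unfold dotN
        rw [← Finset.sum_add_distrib]
        by_cases hω : ω ∈ A K
        · rw [Set.indicator_of_mem hω]
          simp only [hh, dotN]
          refine Finset.sum_congr rfl fun t _ => ?_
          by_cases ht : t = t0 <;> simp [hb, hr, ht, hω]
        · rw [Set.indicator_of_notMem hω]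
          refine Finset.sum_eq_zero fun t _ => ?_
          by_cases ht : t = t0 <;> simp [hb, hr, ht, hω]
      obtain ⟨hrI, hr0⟩ := ih r hrN (by
          intro t ht ω
          by_cases h1 : t = t0
          · simp [hr, h1]
          · have : t < t0 := by
              rw [Fin.lt_def]
              have : t.val ≠ t0.val := fun h => h1 (Fin.ext h)
              simp only [ht0] at this ⊢
              omega
            simp [hr, hlt t this])
        (fun ω => |w ω| + |dotN nt (b ω) (v ω)|) (hw.abs.add hbI.abs) (by
          filter_upwards [hle] with ω hω
          have e := hsum ω
          have h1 : (A K).indicator h ω ≤ |w ω| := by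
            by_cases hA : ω ∈ A K
            · rw [Set.indicator_of_mem hA]; exact hω.trans (le_abs_self _)
            · rw [Set.indicator_of_notMem hA]; exact abs_nonneg _
          have := neg_abs_le (dotN nt (b ω) (v ω))
          linarith)
      have e : (A K).indicator h = fun ω => dotN nt (b ω) (v ω) + dotN nt (r ω) (v ω) :=
        funext fun ω => (hsum ω).symm
      rw [e]
      refine ⟨hbI.add hrI, ?_⟩
      rw [integral_add hbI hrI, hb0, hr0, add_zero]
    have hAmono : Monotone A := by
      intro i j hij ω hω
      have h1 : ‖x ω t0‖ ≤ (i : ℝ) := hω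
      have h2 : (i : ℝ) ≤ j := by exact_mod_cast hij
      exact h1.trans h2
    have hind : ∀ K, (A K).indicator (fun ω => |w ω| - h ω)
        = (A K).indicator (fun ω => |w ω|) - (A K).indicator h := by
      intro K
      funext ω
      by_cases hω : ω ∈ A K <;> simp [hω]
    have hAex : ∀ ω, ∃ K, ω ∈ A K := fun ω => exists_nat_ge ‖x ω t0‖
    obtain ⟨G, hGi, -, hG⟩ := aux_mct (P := P)
      (fun K => (A K).indicator (fun ω => |w ω| - h ω))
      (by
        intro K
        rw [hind]
        exact (hw.abs.indicator (hAm' K)).sub (step K).1)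
      (by
        filter_upwards [hle] with ω hω i j hij
        have h4 : h ω ≤ |w ω| := hω.trans (le_abs_self _)
        change (A i).indicator (fun ω => |w ω| - h ω) ω ≤ (A j).indicator (fun ω => |w ω| - h ω) ω
        by_cases hi : ω ∈ A i
        · rw [Set.indicator_of_mem hi, Set.indicator_of_mem (hAmono hij hi)]
        · rw [Set.indicator_of_notMem hi]
          by_cases hj : ω ∈ A j
          · rw [Set.indicator_of_mem hj]; linarith
          · rw [Set.indicator_of_notMem hj])
      (∫ ω, |w ω| ∂P)
      (by
        intro K
        rw [hind]
        rw [integral_sub' (hw.abs.indicator (hAm' K)) (step K).1, (step K).2, sub_zero]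
        refine integral_mono (hw.abs.indicator (hAm' K)) hw.abs ?_
        exact Set.indicator_le_self' fun ω _ => abs_nonneg _)
    have hI : Integrable h P := by
      refine Integrable.mono' (hw.abs.add hGi.abs) hhm.aestronglyMeasurable ?_
      filter_upwards [hle, hG] with ω h1 h2
      obtain ⟨K, hK⟩ := hAex ω
      have h3 := h2 K
      rw [Set.indicator_of_mem hK] at h3
      have h4 : h ω ≤ |w ω| := h1.trans (le_abs_self _)
      have h5 := le_abs_self (G ω)
      have h6 := abs_nonneg (G ω)
      have h7 := abs_nonneg (w ω)
      rw [Real.norm_eq_abs, abs_le]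
      simp only [Pi.add_apply]
      constructor <;> linarith
    refine ⟨hI, ?_⟩
    have ht : Filter.Tendsto (fun K => ∫ ω, (A K).indicator h ω ∂P) Filter.atTop
        (nhds (∫ ω, h ω ∂P)) := by
      refine tendsto_integral_of_dominated_convergence (fun ω => |h ω|)
        (fun K => (step K).1.aestronglyMeasurable) hI.abs ?_ ?_
      · intro K
        refine Filter.Eventually.of_forall fun ω => ?_
        rw [Real.norm_eq_abs]
        by_cases hω : ω ∈ A K <;> simp [hω]
      · refine Filter.Eventually.of_forall fun ω => ?_
        obtain ⟨K, hK⟩ := hAex ω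
        refine tendsto_const_nhds.congr' ?_
        filter_upwards [Filter.eventually_ge_atTop K] with j hj
        rw [Set.indicator_of_mem (hAmono hj hK)]
    simp only [(step _).2] at ht
    exact (tendsto_nhds_unique ht tendsto_const_nhds)

noncomputable def sInd {Ω V : Type} [MeasurableSpace Ω] [Zero V] (A : Set Ω) (hA : MeasurableSet A)
    (c : V) : SimpleFunc Ω V :=
  SimpleFunc.piecewise A hA (SimpleFunc.const _ c) (SimpleFunc.const _ 0)

lemma sInd_apply {Ω V : Type} [MeasurableSpace Ω] [Zero V] (A : Set Ω) (hA : MeasurableSet A)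
    (c : V) (ω : Ω) : sInd A hA c ω = A.indicator (fun _ => c) ω := by
  classical
  by_cases h : ω ∈ A <;> simp [sInd, h]

lemma aux_L_simple {Ω V : Type} [MeasurableSpace Ω] (L : V → Ω → ℝ) (s : SimpleFunc Ω V) :
    (fun ω => L (s ω) ω) = fun ω => ∑ c ∈ s.range, (s ⁻¹' {c}).indicator (L c) ω := by
  classical
  funext ω
  rw [Finset.sum_eq_single (s ω)]
  · simp
  · intro b _ hb
    rw [Set.indicator_of_notMem]
    simpa using hb.symm
  · intro h
    exact absurd (s.mem_range_self ω) h

lemma aux_L_int {Ω V : Type} [MeasurableSpace Ω] {P : Measure Ω} (L : V → Ω → ℝ)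
    (hL : ∀ c, Integrable (L c) P) (s : SimpleFunc Ω V) :
    Integrable (fun ω => L (s ω) ω) P := by
  rw [aux_L_simple]
  exact integrable_finsetSum _ fun c _ => (hL c).indicator (s.measurableSet_fiber c)

lemma aux_L_meas {Ω V : Type} [MeasurableSpace Ω] (L : V → Ω → ℝ)
    (hL : ∀ c, Measurable (L c)) (s : SimpleFunc Ω V) :
    Measurable (fun ω => L (s ω) ω) := by
  rw [aux_L_simple]
  exact Finset.measurable_fun_sum _ fun c _ => (hL c).indicator (s.measurableSet_fiber c)

lemma aux_small {Ω V ι : Type} [MeasurableSpace Ω] {P : Measure Ω} [AddCommGroup V] [Module ℝ V]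
    (L : V → Ω → ℝ) (hL : ∀ c, Integrable (L c) P) (α : ℝ)
    (l : SimpleFunc Ω V →ₗ[ℝ] ℝ) (hl : ∀ s, l s ≤ ∫ ω, L (s ω) ω ∂P - α) (c : V)
    (F : Filter ι) (B : ι → Set Ω) (hB : ∀ i, MeasurableSet (B i))
    (hB0 : Filter.Tendsto (fun i => P (B i)) F (nhds 0)) :
    Filter.Tendsto (fun i => l (sInd (B i) (hB i) c)) F (nhds 0) := by
  have key : ∀ (i : ι) (d : V), l (sInd (B i) (hB i) d) ≤
      (∫ ω, L 0 ω ∂P - α) + ∫ ω in B i, (L d ω - L 0 ω) ∂P := by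
    intro i d
    refine (hl _).trans ?_
    have e : (fun ω => L (sInd (B i) (hB i) d ω) ω) =
        fun ω => L 0 ω + (B i).indicator (fun ω => L d ω - L 0 ω) ω := by
      funext ω
      rw [sInd_apply]
      by_cases h : ω ∈ B i <;> simp [h]
    have hi : Integrable (fun ω => (B i).indicator (fun ω => L d ω - L 0 ω) ω) P :=
      ((hL d).sub (hL 0)).indicator (hB i)
    rw [e, integral_add (hL 0) hi, integral_indicator (hB i)]
    linarith
  have hsm : ∀ (i : ι) (k : ℝ), l (sInd (B i) (hB i) (k • c)) = k * l (sInd (B i) (hB i) c) := by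
    intro i k
    have : sInd (B i) (hB i) (k • c) = k • sInd (B i) (hB i) c := by
      ext ω
      rw [SimpleFunc.smul_apply, sInd_apply, sInd_apply]
      by_cases h : ω ∈ B i <;> simp [h]
    rw [this, map_smul, smul_eq_mul]
  rw [Metric.tendsto_nhds]
  intro ε hε
  set D := ∫ ω, L 0 ω ∂P - α with hD
  set k : ℝ := (2 * (|D| + 1)) / ε with hk
  have hk0 : 0 < k := by positivity
  have hkD : D < k * ε / 2 := by
    have : k * ε / 2 = |D| + 1 := by rw [hk]; field_simp
    rw [this]; linarith [le_abs_self D]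
  have t1 := ((hL (k • c)).sub (hL 0)).tendsto_setIntegral_nhds_zero hB0
  have t2 := ((hL ((-k) • c)).sub (hL 0)).tendsto_setIntegral_nhds_zero hB0
  have hpos : (0:ℝ) < k * ε / 2 := by positivity
  filter_upwards [t1.eventually_lt_const hpos, t2.eventually_lt_const hpos] with i h1 h2
  have a1 := key i (k • c)
  have a2 := key i ((-k) • c)
  rw [hsm] at a1 a2
  simp only [Pi.sub_apply] at h1 h2
  rw [Real.dist_eq, sub_zero, abs_lt]
  constructor <;> nlinarith

lemma aux_rep {Ω V : Type} [MeasurableSpace Ω] {P : Measure Ω} [IsProbabilityMeasure P]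
    [AddCommGroup V] [Module ℝ V]
    (L : V → Ω → ℝ) (hL : ∀ c, Integrable (L c) P) (α : ℝ)
    (l : SimpleFunc Ω V →ₗ[ℝ] ℝ) (hl : ∀ s, l s ≤ ∫ ω, L (s ω) ω ∂P - α) (c : V) :
    ∃ d : Ω → ℝ, Measurable d ∧ Integrable d P ∧
      ∀ A (hA : MeasurableSet A), l (sInd A hA c) = ∫ ω in A, d ω ∂P := by
  classical
  set ν : Set Ω → ℝ := fun A => if hA : MeasurableSet A then l (sInd A hA c) else 0 with hν
  have hνm : ∀ A (hA : MeasurableSet A), ν A = l (sInd A hA c) := fun A hA => by simp [hν, hA]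
  have hadd : ∀ A B, MeasurableSet A → MeasurableSet B → Disjoint A B →
      ν (A ∪ B) = ν A + ν B := by
    intro A B hA hB hd
    rw [hνm _ hA, hνm _ hB, hνm _ (hA.union hB), ← map_add]
    congr 1
    ext ω
    rw [SimpleFunc.add_apply, sInd_apply, sInd_apply, sInd_apply,
      Set.indicator_union_of_disjoint hd]
  have h0 : ν ∅ = 0 := by
    have := hadd ∅ ∅ .empty .empty (by simp)
    rw [Set.union_self] at this
    linarith
  have hfin : ∀ (f : ℕ → Set Ω), (∀ i, MeasurableSet (f i)) → Pairwise (Function.onFun Disjoint f) →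
      ∀ s : Finset ℕ, ν (⋃ i ∈ s, f i) = ∑ i ∈ s, ν (f i) := by
    intro f hf hd s
    induction s using Finset.induction_on with
    | empty => simp [h0]
    | insert a s ha ih =>
      rw [Finset.set_biUnion_insert, Finset.sum_insert ha, hadd _ _ (hf a)
        (Finset.measurableSet_biUnion _ fun i _ => hf i), ih]
      rw [Set.disjoint_iUnion₂_right]
      intro i hi
      exact hd (fun h => ha (h ▸ hi))
  let sm : SignedMeasure Ω :=
    { measureOf' := ν
      empty' := h0
      not_measurable' := fun A hA => by simp [hν, hA]
      m_iUnion' := by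
        intro f hf hd
        set R : Finset ℕ → Set Ω := fun s => ⋃ i : {i // i ∉ s}, f i with hR
        have hRm : ∀ s, MeasurableSet (R s) := fun s => MeasurableSet.iUnion fun i => hf i
        have hsplit : ∀ s, ν (⋃ i, f i) = ∑ i ∈ s, ν (f i) + ν (R s) := by
          intro s
          rw [← hfin f hf hd, ← hadd _ _ (Finset.measurableSet_biUnion _ fun i _ => hf i) (hRm s)]
          · congr 1
            ext ω
            simp only [hR, Set.mem_iUnion, Set.mem_union, Subtype.exists, exists_prop]
            constructor
            · rintro ⟨i, hi⟩
              by_cases h : i ∈ s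
              · exact Or.inl ⟨i, h, hi⟩
              · exact Or.inr ⟨i, h, hi⟩
            · rintro (⟨i, _, hi⟩ | ⟨i, _, hi⟩) <;> exact ⟨i, hi⟩
          · rw [Set.disjoint_iUnion₂_left]
            intro i hi
            rw [hR, Set.disjoint_iUnion_right]
            rintro ⟨j, hj⟩
            refine hd (fun h => hj ?_)
            have h' : i = j := h
            exact h' ▸ hi
        have hP : Filter.Tendsto (fun s => P (R s)) Filter.atTop (nhds 0) := by
          have := ENNReal.tendsto_tsum_compl_atTop_zero (f := fun i => P (f i))
            (by rw [← measure_iUnion hd hf]; exact measure_ne_top _ _)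
          exact tendsto_of_tendsto_of_tendsto_of_le_of_le tendsto_const_nhds this
            (fun _ => bot_le) (fun s => measure_iUnion_le _)
        have ht := aux_small L hL α l hl c Filter.atTop R hRm hP
        have : Filter.Tendsto (fun s => ν (⋃ i, f i) - ν (R s)) Filter.atTop
            (nhds (ν (⋃ i, f i) - 0)) := by
          refine tendsto_const_nhds.sub (ht.congr fun s => ?_)
          rw [hνm]
        rw [sub_zero] at this
        refine this.congr fun s => ?_
        rw [hsplit s]; ring }
  have hac : VectorMeasure.AbsolutelyContinuous sm P.toENNRealVectorMeasure := by
    refine VectorMeasure.AbsolutelyContinuous.mk fun A hA hA0 => ?_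
    rw [Measure.toENNRealVectorMeasure_apply_measurable hA] at hA0
    change ν A = 0
    rw [hνm A hA]
    have := aux_small L hL α l hl c (Filter.atTop : Filter ℕ) (fun _ => A) (fun _ => hA)
      (by simp [hA0])
    exact tendsto_nhds_unique tendsto_const_nhds this
  have hrn := SignedMeasure.withDensityᵥ_rnDeriv_eq sm P hac
  refine ⟨sm.rnDeriv P, SignedMeasure.measurable_rnDeriv _ _, SignedMeasure.integrable_rnDeriv _ _,
    fun A hA => ?_⟩
  rw [← withDensityᵥ_apply (SignedMeasure.integrable_rnDeriv _ _) hA, hrn]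
  exact (hνm A hA).symm

lemma aux_cond {Ω : Type} [mΩ : MeasurableSpace Ω] {P : Measure Ω} [IsProbabilityMeasure P]
    {m0 : MeasurableSpace Ω} (hm : m0 ≤ mΩ) {x d : Ω → ℝ} (hx : Measurable[m0] x)
    (M : ℝ) (hM : ∀ᵐ ω ∂P, ‖x ω‖ ≤ M) (hd : Integrable d P)
    (h0 : ∀ A, MeasurableSet[m0] A → ∫ ω in A, d ω ∂P = 0) :
    ∫ ω, x ω * d ω ∂P = 0 := by
  have h1 : P[d | m0] =ᵐ[P] fun _ => 0 := by
    symm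
    refine ae_eq_condExp_of_forall_setIntegral_eq hm hd (fun s _ _ => by simp) ?_ ?_
    · intro s hs _
      simp [h0 s hs]
    · exact stronglyMeasurable_const.aestronglyMeasurable
  have h2 := condExp_stronglyMeasurable_mul_of_bound hm (hx.stronglyMeasurable) hd M hM
  rw [← integral_condExp hm]
  change ∫ ω, (P[x * d | m0]) ω ∂P = 0
  rw [integral_congr_ae h2]
  have : (x * P[d | m0]) =ᵐ[P] fun _ => 0 := by
    filter_upwards [h1] with ω h
    simp [h]
  rw [integral_congr_ae this]
  simp

lemma dotN_add {T : ℕ} {nt : Fin (T+1) → ℕ} (a b c : Vec nt) :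
    dotN nt (a + b) c = dotN nt a c + dotN nt b c := by
  simp [dotN, add_mul, Finset.sum_add_distrib]

lemma dotN_continuous {T : ℕ} {nt : Fin (T+1) → ℕ} (c : Vec nt) :
    Continuous (fun a => dotN nt a c) := by
  unfold dotN
  fun_prop

lemma aux_core {Ω : Type} [mΩ : MeasurableSpace Ω] (P : Measure Ω) [IsProbabilityMeasure P]
    {T : ℕ} (ℱ : Fin (T+1) → MeasurableSpace Ω)
    (hℱ_le : ∀ t, ℱ t ≤ mΩ)
    (nt : Fin (T+1) → ℕ) (L : Vec nt → Ω → ℝ) (hLm : ∀ c, Measurable (L c))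
    (hL : ∀ c, Integrable (L c) P)
    (hconv : ∀ᵐ ω ∂P, ConvexOn ℝ Set.univ (fun c => L c ω)) (α : ℝ)
    (hα : ∀ s : SimpleFunc Ω (Vec nt), (s : Ω → Vec nt) ∈ Nspace nt ℱ →
      α ≤ ∫ ω, L (s ω) ω ∂P) :
    ∃ v ∈ Nperp nt ℱ P, ∃ G : Ω → ℝ, Integrable G P ∧ ∫ ω, G ω ∂P ≤ -α ∧
      ∀ᵐ ω ∂P, ∀ x, dotN nt x (v ω) - L x ω ≤ G ω := by
  classical
  let N : Submodule ℝ (SimpleFunc Ω (Vec nt)) :=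
    { carrier := {s | (s : Ω → Vec nt) ∈ Nspace nt ℱ}
      add_mem' := fun {a b} ha hb t => (ha t).add (hb t)
      zero_mem' := fun t => measurable_const
      smul_mem' := fun c a ha t => (ha t).const_smul c }
  obtain ⟨l, hlN, hl⟩ := aux_HB N (fun s => ∫ ω, L (s ω) ω ∂P) (by
    intro a b x y ha hb hab
    have hx := aux_L_int L hL x
    have hy := aux_L_int L hL y
    rw [← integral_const_mul, ← integral_const_mul,
      ← integral_add (hx.const_mul a) (hy.const_mul b)]
    refine integral_mono_ae (aux_L_int L hL _) ((hx.const_mul a).add (hy.const_mul b)) ?_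
    filter_upwards [hconv] with ω h
    exact h.2 (Set.mem_univ (x ω)) (Set.mem_univ (y ω)) ha.le hb.le hab) α hα
  choose d hdm hdi hd using fun c => aux_rep L hL α l hl c
  set e : (t : Fin (T+1)) → Fin (nt t) → Vec nt := fun t i => Pi.single t (Pi.single i 1) with he
  set v : Ω → Vec nt := fun ω t i => d (e t i) ω with hv
  have hvm : Measurable v :=
    measurable_pi_lambda _ fun t => measurable_pi_lambda _ fun i => hdm _
  have hvi : Integrable v P := Integrable.of_eval fun t => Integrable.of_eval fun i => hdi _
  have hz : ∀ t i (A : Set Ω), MeasurableSet[ℱ t] A → ∫ ω in A, d (e t i) ω ∂P = 0 := by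
    intro t i A hA
    rw [← hd (e t i) A (hℱ_le t A hA)]
    apply hlN
    intro t'
    have : (fun ω => sInd A (hℱ_le t A hA) (e t i) ω t') =
        A.indicator (fun _ => e t i t') := by
      funext ω
      rw [sInd_apply]
      by_cases h : ω ∈ A <;> simp [h]
    rw [this]
    by_cases h : t' = t
    · subst h
      exact Measurable.indicator measurable_const hA
    · have : e t i t' = 0 := by simp [he, h]
      rw [this, Set.indicator_zero]
      exact measurable_const
  have hperp : v ∈ Nperp nt ℱ P := by
    refine ⟨hvm, hvi, ?_⟩
    rintro x ⟨hx, M, hM⟩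
    have hb : ∀ t i, ∀ᵐ ω ∂P, ‖x ω t i‖ ≤ M := by
      intro t i
      filter_upwards [hM] with ω h
      exact ((norm_le_pi_norm _ i).trans (norm_le_pi_norm (x ω) t)).trans h
    have hxm := Nspace_measurable hℱ_le hx
    have hi : ∀ t i, Integrable (fun ω => x ω t i * v ω t i) P := fun t i =>
      (hdi (e t i)).bdd_mul (c := M)
        ((measurable_pi_apply i).comp ((measurable_pi_apply t).comp hxm)).aestronglyMeasurable
        (hb t i)
    unfold dotN
    rw [integral_finsetSum _ fun t _ => integrable_finsetSum _ fun i _ => hi t i]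
    refine Finset.sum_eq_zero fun t _ => ?_
    rw [integral_finsetSum _ fun i _ => hi t i]
    refine Finset.sum_eq_zero fun i _ => ?_
    exact aux_cond (hℱ_le t) ((measurable_pi_apply i).comp (hx t)) M (hb t i) (hdi _) (hz t i)
  have hsI : ∀ s : SimpleFunc Ω (Vec nt), Integrable (fun ω => dotN nt (s ω) (v ω)) P := by
    intro s
    refine dotN_integrable s.measurable ?_ hvi
    obtain ⟨C, hC⟩ := s.exists_forall_norm_le
    exact ⟨C, Filter.Eventually.of_forall hC⟩
  have hrep : ∀ s : SimpleFunc Ω (Vec nt), l s = ∫ ω, dotN nt (s ω) (v ω) ∂P := by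
    intro s
    induction s using SimpleFunc.induction with
    | @const c A hA =>
      change l (sInd A hA c) = ∫ ω, dotN nt (sInd A hA c ω) (v ω) ∂P
      have e1 : sInd A hA c = ∑ t, ∑ i, c t i • sInd A hA (e t i) := by
        let Λ : Vec nt →ₗ[ℝ] SimpleFunc Ω (Vec nt) :=
          { toFun := fun c => sInd A hA c
            map_add' := fun a b => by
              ext1 ω
              rw [SimpleFunc.add_apply, sInd_apply, sInd_apply, sInd_apply]
              by_cases h : ω ∈ A <;> simp [h]
            map_smul' := fun a b => by
              ext1 ω
              rw [RingHom.id_apply, SimpleFunc.smul_apply, sInd_apply, sInd_apply]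
              by_cases h : ω ∈ A <;> simp [h] }
        have ec : c = ∑ t, ∑ i, c t i • e t i := by
          funext t' i'
          simp only [Finset.sum_apply, Pi.smul_apply, smul_eq_mul, he]
          rw [Finset.sum_eq_single t', Finset.sum_eq_single i']
          · simp
          · intro b _ hb
            simp [hb.symm]
          · simp
          · intro b _ hb
            refine Finset.sum_eq_zero fun i _ => ?_
            simp [hb.symm]
          · simp
        change Λ c = ∑ t, ∑ i, c t i • Λ (e t i)
        conv_lhs => rw [ec]
        simp only [map_sum, map_smul]
      rw [e1]
      simp only [map_sum, map_smul, smul_eq_mul, hd]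
      have e2 : (fun ω => dotN nt (sInd A hA c ω) (v ω)) =
          A.indicator (fun ω => dotN nt c (v ω)) := by
        funext ω
        rw [sInd_apply]
        by_cases h : ω ∈ A <;> simp [h, dotN]
      rw [← e1, e2, integral_indicator hA]
      unfold dotN
      rw [integral_finsetSum _ fun t _ => integrable_finsetSum _ fun i _ =>
        ((hdi (e t i)).const_mul (c t i)).integrableOn]
      refine Finset.sum_congr rfl fun t _ => ?_
      rw [integral_finsetSum _ fun i _ => ((hdi (e t i)).const_mul (c t i)).integrableOn]
      refine Finset.sum_congr rfl fun i _ => ?_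
      rw [integral_const_mul]
    | @add f g hfg hf hg =>
      rw [map_add, hf, hg, ← integral_add (hsI f) (hsI g)]
      refine integral_congr_ae (Filter.Eventually.of_forall fun ω => ?_)
      exact (dotN_add _ _ _).symm
  set F : Vec nt → Ω → ℝ := fun c ω => dotN nt c (v ω) - L c ω with hF
  have hFm : ∀ c, Measurable (F c) := fun c => (dotN_measurable measurable_const hvm).sub (hLm c)
  set q : ℕ → Vec nt := TopologicalSpace.denseSeq (Vec nt) with hq
  have hsel : ∀ K, ∃ s : SimpleFunc Ω (Vec nt), ∀ ω,
      partialSups (fun k => F (q k)) K ω = F (s ω) ω := by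
    intro K
    induction K with
    | zero => exact ⟨SimpleFunc.const _ (q 0), fun ω => by simp⟩
    | succ K ih =>
      obtain ⟨s, hs⟩ := ih
      have hA : MeasurableSet {ω | F (s ω) ω < F (q (K+1)) ω} :=
        measurableSet_lt (aux_L_meas F hFm s) (hFm _)
      refine ⟨SimpleFunc.piecewise _ hA (SimpleFunc.const _ (q (K+1))) s, fun ω => ?_⟩
      have hsc := partialSups_succ (fun k => F (q k)) K
      rw [Order.succ_eq_add_one] at hsc
      rw [hsc, Pi.sup_apply, hs ω]
      rw [SimpleFunc.piecewise_apply]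
      by_cases h : F (s ω) ω < F (q (K+1)) ω
      · rw [if_pos (show ω ∈ {ω | F (s ω) ω < F (q (K+1)) ω} from h)]
        exact sup_of_le_right h.le
      · rw [if_neg (show ω ∉ {ω | F (s ω) ω < F (q (K+1)) ω} from h)]
        exact sup_of_le_left (not_lt.1 h)
  choose s hs using hsel
  have hps : ∀ K, partialSups (fun k => F (q k)) K =
      fun ω => dotN nt (s K ω) (v ω) - L (s K ω) ω := fun K => funext (hs K)
  obtain ⟨G, hGi, hGC, hG⟩ := aux_mct (P := P) (fun K => partialSups (fun k => F (q k)) K)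
    (fun K => by
      rw [hps]
      exact (hsI _).sub (aux_L_int L hL _))
    (Filter.Eventually.of_forall fun ω i j hij => (partialSups (fun k => F (q k))).mono hij ω) (-α)
    (fun K => by
      rw [hps, integral_sub (hsI _) (aux_L_int L hL _), ← hrep]
      have := hl (s K)
      linarith)
  refine ⟨v, hperp, G, hGi, hGC, ?_⟩
  filter_upwards [hG, hconv] with ω h1 h2
  have hc : Continuous (fun c => L c ω) := by
    rw [← continuousOn_univ]
    exact h2.continuousOn isOpen_univ
  have hcl : IsClosed {x : Vec nt | dotN nt x (v ω) - L x ω ≤ G ω} :=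
    isClosed_le ((dotN_continuous _).sub hc) continuous_const
  have hden : Dense {x : Vec nt | dotN nt x (v ω) - L x ω ≤ G ω} := by
    refine (TopologicalSpace.denseRange_denseSeq (Vec nt)).mono ?_
    rintro _ ⟨k, rfl⟩
    exact (le_partialSups (fun k => F (q k)) k ω).trans (h1 k)
  intro x
  have : x ∈ closure {x : Vec nt | dotN nt x (v ω) - L x ω ≤ G ω} := hden x
  rwa [hcl.closure_eq] at this

lemma aux_fin {Ω : Type} [mΩ : MeasurableSpace Ω] {P : Measure Ω}
    {T : ℕ} {nt : Fin (T+1) → ℕ} (f : Vec nt → Ω → EReal)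
    (hbot : ∀ ω x, f x ω ≠ ⊥)
    (hconv : ∀ (ω : Ω) (a b : ℝ) (x₁ x₂ : Vec nt), 0 < a → 0 < b → a + b = 1 →
      f (a • x₁ + b • x₂) ω ≤ (a : EReal) * f x₁ ω + (b : EReal) * f x₂ ω)
    (hc : ∀ c, ∀ᵐ ω ∂P, f c ω ≠ ⊤) :
    ∀ᵐ ω ∂P, ∀ x, f x ω = (((f x ω).toReal : ℝ) : EReal) := by
  have h1 : ∀ᵐ ω ∂P, ∀ z : (t : Fin (T+1)) → Fin (nt t) → ℤ,
      f (fun t i => (z t i : ℝ)) ω ≠ ⊤ := by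
    rw [ae_all_iff]
    exact fun z => hc _
  filter_upwards [h1] with ω hω x
  symm
  refine EReal.coe_toReal ?_ (hbot ω x)
  have hC : Convex ℝ {x | f x ω ≠ ⊤} := by
    rw [convex_iff_forall_pos]
    intro x hx y hy a b ha hb hab
    have := hconv ω a b x y ha hb hab
    refine ne_top_of_le_ne_top ?_ this
    lift f x ω to ℝ using ⟨hx, hbot ω x⟩ with p
    lift f y ω to ℝ using ⟨hy, hbot ω y⟩ with q
    rw [← EReal.coe_mul, ← EReal.coe_mul, ← EReal.coe_add]
    exact EReal.coe_ne_top _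
  have hZ : convexHull ℝ (Set.range (Int.cast : ℤ → ℝ)) = Set.univ := by
    rw [Set.eq_univ_iff_forall]
    intro r
    have hs : segment ℝ ((⌊r⌋ : ℤ) : ℝ) ((⌊r⌋ + 1 : ℤ) : ℝ) ⊆
        convexHull ℝ (Set.range (Int.cast : ℤ → ℝ)) :=
      segment_subset_convexHull ⟨_, rfl⟩ ⟨_, rfl⟩
    apply hs
    rw [segment_eq_Icc (by push_cast; linarith)]
    exact ⟨Int.floor_le r, by push_cast; exact (Int.lt_floor_add_one r).le⟩
  have hH : convexHull ℝ (Set.pi Set.univ (fun t : Fin (T+1) =>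
      Set.pi Set.univ (fun _ : Fin (nt t) => Set.range (Int.cast : ℤ → ℝ)))) = Set.univ := by
    rw [convexHull_pi]
    have : ∀ t : Fin (T+1), convexHull ℝ (Set.pi Set.univ
        (fun _ : Fin (nt t) => Set.range (Int.cast : ℤ → ℝ))) = Set.univ := by
      intro t
      rw [convexHull_pi]
      simp [hZ]
    simp [this]
  have hsub : convexHull ℝ (Set.pi Set.univ (fun t : Fin (T+1) =>
      Set.pi Set.univ (fun _ : Fin (nt t) => Set.range (Int.cast : ℤ → ℝ)))) ⊆
      {x | f x ω ≠ ⊤} := by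
    refine convexHull_min ?_ hC
    intro z hz
    simp only [Set.mem_pi, Set.mem_univ, true_implies, Set.mem_range] at hz
    choose w hw using hz
    have : z = fun t i => (w t i : ℝ) := by
      funext t i; exact (hw t i).symm
    rw [this]
    exact hω w
  rw [hH] at hsub
  exact hsub (Set.mem_univ x)

lemma aux_convexOn {T : ℕ} {nt : Fin (T+1) → ℕ} (f : Vec nt → EReal)
    (hfin : ∀ x, f x = (((f x).toReal : ℝ) : EReal))
    (hconv : ∀ (a b : ℝ) (x₁ x₂ : Vec nt), 0 < a → 0 < b → a + b = 1 →
      f (a • x₁ + b • x₂) ≤ (a : EReal) * f x₁ + (b : EReal) * f x₂) :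
    ConvexOn ℝ Set.univ (fun x => (f x).toReal) := by
  rw [convexOn_iff_forall_pos]
  refine ⟨convex_univ, ?_⟩
  intro x _ y _ a b ha hb hab
  have := hconv a b x y ha hb hab
  rw [hfin x, hfin y, hfin (a • x + b • y)] at this
  rw [← EReal.coe_mul, ← EReal.coe_mul, ← EReal.coe_add, EReal.coe_le_coe_iff] at this
  exact this

lemma aux_A {Ω : Type} {T : ℕ} {nt : Fin (T+1) → ℕ} {m : ℕ}
    (f0 : Vec nt → Ω → EReal) (fj : Fin m → Vec nt → Ω → EReal) (ω : Ω)
    (h0 : ∀ x, f0 x ω = (((f0 x ω).toReal : ℝ) : EReal))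
    (hj : ∀ j x, fj j x ω = (((fj j x ω).toReal : ℝ) : EReal))
    (v : Vec nt) (y : Fin m → ℝ) (hy : ∀ j, 0 ≤ y j) (x : Vec nt) (u : Fin m → ℝ) :
    ((dotN nt x v + dotM u y : ℝ) : EReal) - fCon f0 fj x u ω ≤
      ((dotN nt x v - ((f0 x ω).toReal + ∑ j, y j * (fj j x ω).toReal) : ℝ) : EReal) := by
  unfold fCon
  split_ifs with h
  · rw [h0 x, ← EReal.coe_sub, EReal.coe_le_coe_iff, EReal.toReal_coe]
    have : dotM u y ≤ - ∑ j, y j * (fj j x ω).toReal := by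
      unfold dotM
      rw [← Finset.sum_neg_distrib]
      refine Finset.sum_le_sum fun j _ => ?_
      have h1 := h j
      rw [hj j x] at h1
      have h2 : (fj j x ω).toReal + u j ≤ 0 := by exact_mod_cast h1
      nlinarith [hy j]
    linarith
  · simp

lemma aux_B {Ω : Type} {T : ℕ} {nt : Fin (T+1) → ℕ} {m : ℕ}
    (f0 : Vec nt → Ω → EReal) (fj : Fin m → Vec nt → Ω → EReal) (ω : Ω)
    (h0 : ∀ x, f0 x ω = (((f0 x ω).toReal : ℝ) : EReal))
    (hj : ∀ j x, fj j x ω = (((fj j x ω).toReal : ℝ) : EReal))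
    (v : Vec nt) (y : Fin m → ℝ) (x : Vec nt) :
      ((dotN nt x v - ((f0 x ω).toReal + ∑ j, y j * (fj j x ω).toReal) : ℝ) : EReal)
      ≤ fconj (fCon f0 fj) v y ω := by
  unfold fconj
  refine le_iSup₂_of_le x (fun j => - (fj j x ω).toReal) ?_
  have : fCon f0 fj x (fun j => - (fj j x ω).toReal) ω = f0 x ω := by
    unfold fCon
    rw [if_pos]
    intro j
    rw [hj j x, ← EReal.coe_add]
    simp
  rw [this, h0 x, ← EReal.coe_sub, EReal.coe_le_coe_iff, EReal.toReal_coe]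
  have : dotM (fun j => - (fj j x ω).toReal) y = - ∑ j, y j * (fj j x ω).toReal := by
    unfold dotM
    rw [← Finset.sum_neg_distrib]
    exact Finset.sum_congr rfl fun j _ => by ring
  rw [this]; linarith

lemma aux_C {Ω : Type} {T : ℕ} {nt : Fin (T+1) → ℕ} {m : ℕ}
    (f0 : Vec nt → Ω → EReal) (fj : Fin m → Vec nt → Ω → EReal) (ω : Ω)
    (h0 : ∀ x, f0 x ω = (((f0 x ω).toReal : ℝ) : EReal))
    (hj : ∀ j x, fj j x ω = (((fj j x ω).toReal : ℝ) : EReal))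
    (v : Vec nt) (y : Fin m → ℝ) (j₀ : Fin m) (hy : y j₀ < 0) :
      fconj (fCon f0 fj) v y ω = ⊤ := by
  classical
  rw [EReal.eq_top_iff_forall_lt]
  intro r
  have key : ∀ k : ℝ, 0 ≤ k → ((dotN nt 0 v + (dotM (fun j => - (fj j 0 ω).toReal) y - k * y j₀)
      - (f0 0 ω).toReal : ℝ) : EReal) ≤ fconj (fCon f0 fj) v y ω := by
    intro k hk
    unfold fconj
    refine le_iSup₂_of_le 0 (fun j => - (fj j 0 ω).toReal - if j = j₀ then k else 0) ?_
    have : fCon f0 fj 0 (fun j => - (fj j 0 ω).toReal - if j = j₀ then k else 0) ω = f0 0 ω := by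
      unfold fCon
      rw [if_pos]
      intro j
      rw [hj j 0, ← EReal.coe_add]
      have h2 : (fj j 0 ω).toReal + (- (fj j 0 ω).toReal - if j = j₀ then k else 0) ≤ 0 := by
        split_ifs <;> linarith
      exact_mod_cast h2
    rw [this, h0 0, ← EReal.coe_sub, EReal.coe_le_coe_iff, EReal.toReal_coe]
    have : dotM (fun j => - (fj j 0 ω).toReal - if j = j₀ then k else 0) y =
        dotM (fun j => - (fj j 0 ω).toReal) y - k * y j₀ := by
      simp [dotM, sub_mul, Finset.sum_sub_distrib]
    rw [this]
  set c := dotN nt 0 v + dotM (fun j => - (fj j 0 ω).toReal) y - (f0 0 ω).toReal with hc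
  refine lt_of_lt_of_le ?_ (key ((|r - c| + 1) / (- y j₀)) (by
    have : 0 < - y j₀ := by linarith
    positivity))
  rw [EReal.coe_lt_coe_iff]
  have : (|r - c| + 1) / (- y j₀) * y j₀ = - (|r - c| + 1) := by
    field_simp [hy.ne]
  have h3 := le_abs_self (r - c)
  linarith

lemma aux_sub {r : ℝ} {I C : EReal} : (r : EReal) - I ≤ C ↔ (r : EReal) - C ≤ I := by
  induction I with
  | bot =>
    induction C with
    | bot => simp
    | coe c => rw [← EReal.coe_sub]; simp [sub_eq_add_neg]
    | top => simp
  | coe a =>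
    induction C with
    | bot => rw [← EReal.coe_sub]; simp [sub_eq_add_neg]
    | coe c =>
      rw [← EReal.coe_sub, ← EReal.coe_sub, EReal.coe_le_coe_iff, EReal.coe_le_coe_iff]
      constructor <;> intro h <;> linarith
    | top => simp
  | top => simp

lemma aux_weak {Ω : Type} [mΩ : MeasurableSpace Ω] (P : Measure Ω) [IsProbabilityMeasure P]
    {T : ℕ} (ℱ : Fin (T+1) → MeasurableSpace Ω)
    (hℱ_le : ∀ t, ℱ t ≤ mΩ) (hℱ_mono : Monotone ℱ)
    (nt : Fin (T+1) → ℕ) {m : ℕ}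
    (f0 : Vec nt → Ω → EReal) (fj : Fin m → Vec nt → Ω → EReal)
    (hf0_meas : Measurable (fun p : Vec nt × Ω => f0 p.1 p.2))
    (hfj_meas : ∀ j, Measurable (fun p : Vec nt × Ω => fj j p.1 p.2))
    (hfin0 : ∀ᵐ ω ∂P, ∀ x, f0 x ω = (((f0 x ω).toReal : ℝ) : EReal))
    (hfinj : ∀ᵐ ω ∂P, ∀ j x, fj j x ω = (((fj j x ω).toReal : ℝ) : EReal))
    (y : Ω → Fin m → ℝ) (hym : Measurable y) (hy : ∀ᵐ ω ∂P, ∀ j, 0 ≤ y ω j)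
    (hLi : ∀ c, Integrable (fun ω => (f0 c ω).toReal + ∑ j, y ω j * (fj j c ω).toReal) P)
    (hconv : ∀ᵐ ω ∂P, ConvexOn ℝ Set.univ
      (fun c => (f0 c ω).toReal + ∑ j, y ω j * (fj j c ω).toReal))
    (v : Ω → Vec nt) (hv : v ∈ Nperp nt ℱ P) (x : Ω → Vec nt) (hx : x ∈ Nspace nt ℱ)
    (u : Ω → Fin m → ℝ) (hum : Measurable u) (hub : Integrable (fun ω => dotM (u ω) (y ω)) P) :
    ((pairing P u y : ℝ) : EReal) - intF P (fCon f0 fj) x u ≤ intFconj P (fCon f0 fj) v y := by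
  have hvm := hv.1
  have hvi := hv.2.1
  have hxm := Nspace_measurable hℱ_le hx
  have hf0x : Measurable (fun ω => f0 (x ω) ω) := hf0_meas.comp (hxm.prodMk measurable_id)
  have hfjx : ∀ j, Measurable (fun ω => fj j (x ω) ω) := fun j =>
    (hfj_meas j).comp (hxm.prodMk measurable_id)
  have hfm : Measurable (fun ω => fCon f0 fj (x ω) (u ω) ω) := by
    unfold fCon
    refine Measurable.ite ?_ hf0x measurable_const
    rw [Set.setOf_forall]
    refine MeasurableSet.iInter fun j => measurableSet_le ?_ measurable_const
    exact (hfjx j).add ((measurable_pi_apply j).comp hum).coe_real_ereal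
  set L : Vec nt → Ω → ℝ := fun c ω => (f0 c ω).toReal + ∑ j, y ω j * (fj j c ω).toReal with hL
  have hLm : ∀ c, Measurable (L c) := by
    intro c
    have h1 : Measurable (fun ω => (f0 c ω).toReal) :=
      (hf0_meas.comp (measurable_const.prodMk measurable_id)).ereal_toReal
    have h2 : ∀ j, Measurable (fun ω => (fj j c ω).toReal) := fun j =>
      ((hfj_meas j).comp (measurable_const.prodMk measurable_id)).ereal_toReal
    refine h1.add (Finset.measurable_fun_sum _ fun j _ => ?_)
    exact ((measurable_pi_apply j).comp hym).mul (h2 j)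
  set q : ℕ → Vec nt := TopologicalSpace.denseSeq (Vec nt) with hq
  have hsm : AEMeasurable (fun ω => fconj (fCon f0 fj) (v ω) (y ω) ω) P := by
    refine ⟨fun ω => ⨆ k, ((dotN nt (q k) (v ω) - L (q k) ω : ℝ) : EReal), ?_, ?_⟩
    · refine Measurable.iSup fun k => Measurable.coe_real_ereal ?_
      exact (dotN_measurable measurable_const hvm).sub (hLm _)
    · filter_upwards [hfin0, hfinj, hy, hconv] with ω h0 hj hyω hc
      refine le_antisymm ?_ (iSup_le fun k => aux_B f0 fj ω h0 hj _ _ _)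
      refine iSup₂_le fun a b => (aux_A f0 fj ω h0 hj _ _ hyω a b).trans ?_
      set S : EReal := ⨆ k, ((dotN nt (q k) (v ω) - L (q k) ω : ℝ) : EReal) with hS
      have hcc : Continuous (fun c => L c ω) := by
        rw [← continuousOn_univ]
        exact hc.continuousOn isOpen_univ
      have hcl : IsClosed {x : Vec nt | ((dotN nt x (v ω) - L x ω : ℝ) : EReal) ≤ S} :=
        isClosed_le (continuous_coe_real_ereal.comp ((dotN_continuous _).sub hcc)) continuous_const
      have hden : Dense {x : Vec nt | ((dotN nt x (v ω) - L x ω : ℝ) : EReal) ≤ S} := by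
        refine (TopologicalSpace.denseRange_denseSeq (Vec nt)).mono ?_
        rintro _ ⟨k, rfl⟩
        exact le_iSup (fun k => ((dotN nt (q k) (v ω) - L (q k) ω : ℝ) : EReal)) k
      have : a ∈ closure {x : Vec nt | ((dotN nt x (v ω) - L x ω : ℝ) : EReal) ≤ S} := hden a
      rwa [hcl.closure_eq] at this
  by_cases hF : ∫⁻ ω, epos (fCon f0 fj (x ω) (u ω) ω) ∂P = ⊤
  · have : intF P (fCon f0 fj) x u = ⊤ := by
      unfold intF EE
      rw [if_pos hF]
    rw [this]; simp
  by_cases hG : ∫⁻ ω, epos (fconj (fCon f0 fj) (v ω) (y ω) ω) ∂P = ⊤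
  · have : intFconj P (fCon f0 fj) v y = ⊤ := by
      unfold intFconj EE
      rw [if_pos hG]
    rw [this]; simp
  obtain ⟨S, hSi, hSe, hSE⟩ := EE_real hsm hG
    (g := fun ω => dotN nt 0 (v ω) - L 0 ω)
    ((dotN_integrable (x := fun _ => 0) measurable_const ⟨0, by simp⟩ hvi).sub (hLi 0)) (by
      filter_upwards [hfin0, hfinj] with ω h0 hj
      exact aux_B f0 fj ω h0 hj _ _ _)
  have hFen : ∀ᵐ ω ∂P, ((dotN nt (x ω) (v ω) + dotM (u ω) (y ω) - S ω : ℝ) : EReal) ≤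
      fCon f0 fj (x ω) (u ω) ω := by
    filter_upwards [hSe] with ω h
    rw [EReal.coe_sub, ← aux_sub, ← h]
    exact le_iSup₂_of_le (x ω) (u ω) le_rfl
  have hme : AEMeasurable (fun ω => epos (fCon f0 fj (x ω) (u ω) ω)) P :=
    hfm.ereal_toENNReal.aemeasurable
  have hpI := integrable_toReal_of_lintegral_ne_top hme hF
  obtain ⟨hxvI, hxv0⟩ := aux_perp P ℱ hℱ_le hℱ_mono nt v hv (T+1) x hx
    (fun t ht => by omega)
    (fun ω => (epos (fCon f0 fj (x ω) (u ω) ω)).toReal + S ω - dotM (u ω) (y ω))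
    ((hpI.add hSi).sub hub) (by
      filter_upwards [hFen, ae_lt_top' hme hF] with ω h1 h2
      have h3 : ((dotN nt (x ω) (v ω) + dotM (u ω) (y ω) - S ω : ℝ) : EReal) ≤
          (((epos (fCon f0 fj (x ω) (u ω) ω)).toReal : ℝ) : EReal) := by
        refine h1.trans ?_
        rw [EReal.coe_ennreal_toReal h2.ne]
        exact le_trans (le_max_right 0 _) (EReal.coe_toENNReal_eq_max (x := fCon f0 fj (x ω) (u ω) ω)).ge
      have h4 := EReal.coe_le_coe_iff.1 h3
      linarith)
  obtain ⟨F, hFi, hFe, hFE⟩ := EE_real hfm.aemeasurable hF ((hxvI.add hub).sub hSi) hFen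
  unfold intF intFconj
  rw [hFE, hSE, ← EReal.coe_sub, EReal.coe_le_coe_iff]
  have : ∫ ω, (dotN nt (x ω) (v ω) + dotM (u ω) (y ω) - S ω) ∂P ≤ ∫ ω, F ω ∂P := by
    refine integral_mono_ae ((hxvI.add hub).sub hSi) hFi ?_
    filter_upwards [hFen, hFe] with ω h1 h2
    rw [h2] at h1
    exact EReal.coe_le_coe_iff.1 h1
  have e : ∫ ω, (dotN nt (x ω) (v ω) + dotM (u ω) (y ω) - S ω) ∂P =
      ∫ ω, dotN nt (x ω) (v ω) ∂P + ∫ ω, dotM (u ω) (y ω) ∂P - ∫ ω, S ω ∂P := by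
    have hab : Integrable (fun ω => dotN nt (x ω) (v ω) + dotM (u ω) (y ω)) P := hxvI.add hub
    rw [integral_sub hab hSi, integral_add hxvI hub]
  unfold pairing
  linarith

/-- in the constrained setting, for every `y ∈ 𝓨` there exists `v ∈ 𝓝^⊥` with
`Ef*(v,y) = φ̃*(y)`; consequently `φ*(y) = φ̃*(y) = min_{v∈𝓝^⊥} Ef*(v,y)`. -/
theorem stmt_7
    {Ω : Type} [mΩ : MeasurableSpace Ω] (P : Measure Ω) [IsProbabilityMeasure P]
    {T : ℕ} (ℱ : Fin (T+1) → MeasurableSpace Ω)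
    (hℱ_le : ∀ t, ℱ t ≤ mΩ) (hℱ_mono : Monotone ℱ)
    (nt : Fin (T+1) → ℕ) {m : ℕ}
    -- the convex normal integrands `f_0, f_1, …, f_m`
    (f0 : Vec nt → Ω → EReal) (fj : Fin m → Vec nt → Ω → EReal)
    (hf0_meas : Measurable (fun p : Vec nt × Ω => f0 p.1 p.2))
    (hfj_meas : ∀ j, Measurable (fun p : Vec nt × Ω => fj j p.1 p.2))
    (hf0_proper : ∀ ω, (∀ x, f0 x ω ≠ ⊥) ∧ ∃ x, f0 x ω ≠ ⊤)
    (hfj_proper : ∀ j ω, (∀ x, fj j x ω ≠ ⊥) ∧ ∃ x, fj j x ω ≠ ⊤)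
    (hf0_lsc : ∀ ω, LowerSemicontinuous (fun x => f0 x ω))
    (hfj_lsc : ∀ j ω, LowerSemicontinuous (fun x => fj j x ω))
    (hf0_convex : ∀ (ω : Ω) (a b : ℝ) (x₁ x₂ : Vec nt), 0 < a → 0 < b → a + b = 1 →
      f0 (a • x₁ + b • x₂) ω ≤ (a : EReal) * f0 x₁ ω + (b : EReal) * f0 x₂ ω)
    (hfj_convex : ∀ (j : Fin m) (ω : Ω) (a b : ℝ) (x₁ x₂ : Vec nt),
      0 < a → 0 < b → a + b = 1 →
      fj j (a • x₁ + b • x₂) ω ≤ (a : EReal) * fj j x₁ ω + (b : EReal) * fj j x₂ ω)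
    -- `𝓤₀` and `𝓨₀` are decomposable subspaces in separating duality; `𝓤 = 𝓤₀^m`, `𝓨 = 𝓨₀^m`
    (𝓤₀ 𝓨₀ : Set (Ω → ℝ))
    (h𝓤₀meas : ∀ u ∈ 𝓤₀, Measurable u) (h𝓨₀meas : ∀ y ∈ 𝓨₀, Measurable y)
    (h𝓤₀sub : ∀ u ∈ 𝓤₀, ∀ u' ∈ 𝓤₀, ∀ c : ℝ, u + u' ∈ 𝓤₀ ∧ c • u ∈ 𝓤₀)
    (h𝓨₀sub : ∀ y ∈ 𝓨₀, ∀ y' ∈ 𝓨₀, ∀ c : ℝ, y + y' ∈ 𝓨₀ ∧ c • y ∈ 𝓨₀)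
    (h𝓤₀dec : DecomposableR P 𝓤₀) (h𝓨₀dec : DecomposableR P 𝓨₀)
    (hpair : ∀ u ∈ 𝓤₀, ∀ y ∈ 𝓨₀, Integrable (fun ω => u ω * y ω) P)
    (hsep𝓤₀ : ∀ u ∈ 𝓤₀, (∀ y ∈ 𝓨₀, ∫ ω, u ω * y ω ∂P = 0) → u =ᵐ[P] (fun _ => 0))
    (hsep𝓨₀ : ∀ y ∈ 𝓨₀, (∀ u ∈ 𝓤₀, ∫ ω, u ω * y ω ∂P = 0) → y =ᵐ[P] (fun _ => 0))
    (𝓤 𝓨 : Set (Ω → Fin m → ℝ))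
    (h𝓤 : 𝓤 = {u | ∀ j, (fun ω => u ω j) ∈ 𝓤₀})
    (h𝓨 : 𝓨 = {y | ∀ j, (fun ω => y ω j) ∈ 𝓨₀})
    -- for every `x ∈ 𝓝^∞` and every `j = 0,…,m`, `ω ↦ f_j(x(ω),ω)` is finite a.e.
    -- and belongs to `𝓤₀`
    (hfin0 : ∀ x ∈ NspaceInf nt ℱ P, ∃ g ∈ 𝓤₀, ∀ᵐ ω ∂P, f0 (x ω) ω = ((g ω : ℝ) : EReal))
    (hfinj : ∀ x ∈ NspaceInf nt ℱ P, ∀ j, ∃ g ∈ 𝓤₀,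
      ∀ᵐ ω ∂P, fj j (x ω) ω = ((g ω : ℝ) : EReal))
    : ∀ y ∈ 𝓨,
      ∃ v ∈ Nperp nt ℱ P,
        intFconj P (fCon f0 fj) v y = conj P 𝓤 (valueFnInf P (fCon f0 fj) ℱ) y ∧
        conj P 𝓤 (valueFn P (fCon f0 fj) ℱ) y = conj P 𝓤 (valueFnInf P (fCon f0 fj) ℱ) y ∧
        conj P 𝓤 (valueFn P (fCon f0 fj) ℱ) y = intFconj P (fCon f0 fj) v y ∧
        ∀ v' ∈ Nperp nt ℱ P, intFconj P (fCon f0 fj) v y ≤ intFconj P (fCon f0 fj) v' y := by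
  classical
  intro y hy
  rw [h𝓨] at hy
  have hyj : ∀ j, (fun ω => y ω j) ∈ 𝓨₀ := hy
  have hconst : ∀ c : Vec nt, (fun _ => c) ∈ NspaceInf nt ℱ P := fun c =>
    ⟨fun t => measurable_const, ‖c‖, Filter.Eventually.of_forall fun _ => le_rfl⟩
  obtain ⟨g₀, hg₀, -⟩ := hfin0 _ (hconst 0)
  have hUb : ∀ u' : Ω → ℝ, Measurable u' → (∃ M : ℝ, ∀ᵐ ω ∂P, |u' ω| ≤ M) → u' ∈ 𝓤₀ := by
    intro u' h1 h2
    have := h𝓤₀dec ∅ .empty g₀ hg₀ u' h1 h2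
    simpa using this
  have hYne : 𝓨₀.Nonempty := by
    by_contra hne
    rw [Set.not_nonempty_iff_eq_empty] at hne
    have h1 := hsep𝓤₀ (fun _ => 1) (hUb _ measurable_const ⟨1, by simp⟩) (by simp [hne])
    have h2 : ∀ᵐ ω ∂P, False := by
      filter_upwards [h1] with ω h
      exact one_ne_zero h
    simp at h2
    exact IsProbabilityMeasure.ne_zero P h2
  obtain ⟨y₁, hy₁⟩ := hYne
  have hone : (fun _ => (1:ℝ)) ∈ 𝓨₀ := by
    have := h𝓨₀dec ∅ .empty y₁ hy₁ (fun _ => 1) measurable_const ⟨1, by simp⟩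
    simpa using this
  have hUint : ∀ g ∈ 𝓤₀, Integrable g P := by
    intro g hg
    have := hpair g hg _ hone
    simpa using this
  have hym : Measurable y := measurable_pi_lambda _ fun j => h𝓨₀meas _ (hyj j)
  have H0 : ∀ᵐ ω ∂P, ∀ x, f0 x ω = (((f0 x ω).toReal : ℝ) : EReal) := by
    refine aux_fin f0 (fun ω => (hf0_proper ω).1) hf0_convex fun c => ?_
    obtain ⟨g, -, hg⟩ := hfin0 _ (hconst c)
    filter_upwards [hg] with ω h
    rw [h]; exact EReal.coe_ne_top _
  have Hj : ∀ᵐ ω ∂P, ∀ j x, fj j x ω = (((fj j x ω).toReal : ℝ) : EReal) := by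
    rw [ae_all_iff]
    intro j
    refine aux_fin (fj j) (fun ω => (hfj_proper j ω).1) (hfj_convex j) fun c => ?_
    obtain ⟨g, -, hg⟩ := hfinj _ (hconst c) j
    filter_upwards [hg] with ω h
    rw [h]; exact EReal.coe_ne_top _
  set L : Vec nt → Ω → ℝ := fun c ω => (f0 c ω).toReal + ∑ j, y ω j * (fj j c ω).toReal with hL
  have hLm : ∀ c, Measurable (L c) := by
    intro c
    have h1 : Measurable (fun ω => (f0 c ω).toReal) :=
      (hf0_meas.comp (measurable_const.prodMk measurable_id)).ereal_toReal
    have h2 : ∀ j, Measurable (fun ω => (fj j c ω).toReal) := fun j =>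
      ((hfj_meas j).comp (measurable_const.prodMk measurable_id)).ereal_toReal
    refine h1.add (Finset.measurable_fun_sum _ fun j _ => ?_)
    exact ((measurable_pi_apply j).comp hym).mul (h2 j)
  -- pointwise representation of `L` along bounded adapted strategies
  have hLg : ∀ x ∈ NspaceInf nt ℱ P, ∃ g0 ∈ 𝓤₀, ∃ g : Fin m → Ω → ℝ, (∀ j, g j ∈ 𝓤₀) ∧
      (∀ᵐ ω ∂P, f0 (x ω) ω = ((g0 ω : ℝ) : EReal)) ∧
      (∀ᵐ ω ∂P, ∀ j, fj j (x ω) ω = ((g j ω : ℝ) : EReal)) ∧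
      (fun ω => L (x ω) ω) =ᵐ[P] fun ω => g0 ω + ∑ j, g j ω * y ω j := by
    intro x hx
    obtain ⟨g0, hg0, h0⟩ := hfin0 x hx
    choose g hg h1 using hfinj x hx
    have h1' : ∀ᵐ ω ∂P, ∀ j, fj j (x ω) ω = ((g j ω : ℝ) : EReal) := ae_all_iff.2 h1
    refine ⟨g0, hg0, g, hg, h0, h1', ?_⟩
    filter_upwards [h0, h1'] with ω a b
    simp only [hL, a, b, EReal.toReal_coe]
    congr 1
    exact Finset.sum_congr rfl fun j _ => mul_comm _ _
  have hdotI : ∀ g : Fin m → Ω → ℝ, (∀ j, g j ∈ 𝓤₀) →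
      Integrable (fun ω => ∑ j, g j ω * y ω j) P := fun g hg =>
    integrable_finsetSum _ fun j _ => hpair _ (hg j) _ (hyj j)
  have hLi : ∀ c, Integrable (L c) P := by
    intro c
    obtain ⟨g0, hg0, g, hg, -, -, he⟩ := hLg _ (hconst c)
    exact ((hUint _ hg0).add (hdotI g hg)).congr he.symm
  have hlow : ∀ x ∈ NspaceInf nt ℱ P, ∀ g0 ∈ 𝓤₀,
      (∀ᵐ ω ∂P, f0 (x ω) ω = ((g0 ω : ℝ) : EReal)) → ∀ u ∈ 𝓤,
      (∀ᵐ ω ∂P, ∀ j, fj j (x ω) ω + ((u ω j : ℝ) : EReal) ≤ 0) →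
      ((pairing P u y - ∫ ω, g0 ω ∂P : ℝ) : EReal) ≤
        conj P 𝓤 (valueFnInf P (fCon f0 fj) ℱ) y := by
    intro x hx g0 hg0 h0 u hu hle
    refine le_iSup₂_of_le u hu ?_
    rw [EReal.coe_sub]
    refine EReal.sub_le_sub le_rfl ?_
    refine (iInf₂_le x hx).trans ?_
    unfold intF
    rw [← EE_coe (hUint _ hg0)]
    refine EE_mono ?_
    filter_upwards [h0, hle] with ω a b
    unfold fCon
    rw [if_pos b, a]
  have hmono : conj P 𝓤 (valueFnInf P (fCon f0 fj) ℱ) y ≤ conj P 𝓤 (valueFn P (fCon f0 fj) ℱ) y := by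
    refine iSup₂_mono fun u _ => EReal.sub_le_sub le_rfl ?_
    exact le_iInf₂ fun x hx => iInf₂_le x hx.1
  have hconvL : (∀ᵐ ω ∂P, ∀ j, 0 ≤ y ω j) → ∀ᵐ ω ∂P, ConvexOn ℝ Set.univ (fun c => L c ω) := by
    intro hy0
    filter_upwards [hy0, H0, Hj] with ω h1 h2 h3
    refine (aux_convexOn _ h2 (hf0_convex ω)).add ?_
    have : ∀ s : Finset (Fin m), ConvexOn ℝ Set.univ
        (fun c => ∑ j ∈ s, y ω j * (fj j c ω).toReal) := by
      intro s
      induction s using Finset.induction_on with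
      | empty => simpa using convexOn_const (0:ℝ) (convex_univ (𝕜 := ℝ) (E := Vec nt))
      | insert a s ha ih =>
        simp only [Finset.sum_insert ha]
        exact ((aux_convexOn _ (h3 a) (hfj_convex a ω)).smul (h1 a)).add ih
    exact this _
  have hneg : ∀ g ∈ 𝓤₀, ∀ k : ℝ, ∀ b ∈ 𝓤₀, (fun ω => - g ω - k * b ω) ∈ 𝓤₀ := by
    intro g hg k b hb
    have h1 := (h𝓤₀sub g hg g hg (-1)).2
    have h2 := (h𝓤₀sub b hb b hb (-k)).2
    have h3 := (h𝓤₀sub _ h1 _ h2 0).1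
    convert h3 using 1
    funext ω
    simp
    ring
  have hzero𝓤 : (fun _ => (0:ℝ)) ∈ 𝓤₀ := hUb _ measurable_const ⟨0, by simp⟩
  -- if `y` is not nonnegative, the conjugate is infinite
  have htop : ¬ (∀ᵐ ω ∂P, ∀ j, 0 ≤ y ω j) →
      conj P 𝓤 (valueFnInf P (fCon f0 fj) ℱ) y = ⊤ := by
    intro hn
    rw [ae_all_iff] at hn
    push Not at hn
    obtain ⟨j₀, hj₀⟩ := hn
    obtain ⟨g0, hg0, g, hg, h0, h1, -⟩ := hLg _ (hconst 0)
    have hyj0 : Measurable (fun ω => y ω j₀) := h𝓨₀meas _ (hyj j₀)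
    set B : Set Ω := {ω | y ω j₀ < 0} with hB
    have hBm : MeasurableSet B := measurableSet_lt hyj0 measurable_const
    set b : Ω → ℝ := B.indicator (fun _ => 1) with hb
    have hbU : b ∈ 𝓤₀ := by
      refine hUb _ (measurable_const.indicator hBm) ⟨1, Filter.Eventually.of_forall fun ω => ?_⟩
      by_cases h : ω ∈ B <;> simp [hb, h]
    have hbI := hpair b hbU _ (hyj j₀)
    set δ := - ∫ ω, b ω * y ω j₀ ∂P with hδ
    have hby : ∀ ω, 0 ≤ -(b ω * y ω j₀) := by
      intro ω
      by_cases h : ω ∈ B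
      · have : y ω j₀ < 0 := h
        simp [hb, h, this.le]
      · simp [hb, h]
    have hδ0 : 0 < δ := by
      rw [hδ, ← integral_neg]
      refine lt_of_le_of_ne (integral_nonneg hby) ?_
      intro hz
      have := (integral_eq_zero_iff_of_nonneg (μ := P) (f := fun ω => -(b ω * y ω j₀))
        hby hbI.neg).1 hz.symm
      apply hj₀
      filter_upwards [this] with ω hω
      by_contra hc
      have h3 : y ω j₀ < 0 := hc
      have h2 : ω ∈ B := h3
      simp [hb, h2] at hω
      linarith
    rw [EReal.eq_top_iff_forall_lt]
    intro r
    have key : ∀ k : ℝ, 0 ≤ k → ((- ∫ ω, ∑ j, g j ω * y ω j ∂P + k * δ - ∫ ω, g0 ω ∂P : ℝ) : EReal)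
        ≤ conj P 𝓤 (valueFnInf P (fCon f0 fj) ℱ) y := by
      intro k hk
      set u : Ω → Fin m → ℝ := fun ω j => - g j ω - k * (if j = j₀ then b ω else 0) with hu
      have huU : u ∈ 𝓤 := by
        rw [h𝓤]
        intro j
        by_cases h : j = j₀
        · simp only [hu, h, if_true]
          exact hneg _ (hg _) k _ hbU
        · simp only [hu, h, if_false]
          exact hneg _ (hg _) k _ hzero𝓤
      have := hlow _ (hconst 0) g0 hg0 h0 u huU (by
        filter_upwards [h1] with ω hω j
        rw [hω j, ← EReal.coe_add]
        have hbn : 0 ≤ b ω := Set.indicator_nonneg (fun _ _ => zero_le_one) ω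
        have : g j ω + u ω j ≤ 0 := by
          simp only [hu]
          have : 0 ≤ k * (if j = j₀ then b ω else 0) :=
            mul_nonneg hk (by split_ifs; exacts [hbn, le_rfl])
          linarith
        exact_mod_cast this)
      have e : pairing P u y = - ∫ ω, ∑ j, g j ω * y ω j ∂P + k * δ := by
        unfold pairing
        have e1 : ∀ ω, dotM (u ω) (y ω) = -(∑ j, g j ω * y ω j) - k * (b ω * y ω j₀) := by
          intro ω
          simp [dotM, hu, sub_mul, Finset.sum_sub_distrib, mul_assoc]
        simp only [e1]
        have i1 : Integrable (fun ω => -(∑ j, g j ω * y ω j)) P := (hdotI g hg).neg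
        rw [integral_sub i1 (hbI.const_mul k), integral_neg, integral_const_mul, hδ]
        ring
      rwa [e] at this
    set c := - ∫ ω, ∑ j, g j ω * y ω j ∂P - ∫ ω, g0 ω ∂P with hc
    refine lt_of_lt_of_le ?_ (key ((|r - c| + 1) / δ) (by positivity))
    rw [EReal.coe_lt_coe_iff, div_mul_cancel₀ _ hδ0.ne']
    have := le_abs_self (r - c)
    linarith
  -- weak duality
  have hweak : ∀ v' ∈ Nperp nt ℱ P,
      conj P 𝓤 (valueFn P (fCon f0 fj) ℱ) y ≤ intFconj P (fCon f0 fj) v' y := by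
    intro v' hv'
    by_cases hy0 : ∀ᵐ ω ∂P, ∀ j, 0 ≤ y ω j
    · refine iSup₂_le fun u hu => ?_
      rw [aux_sub]
      refine le_iInf₂ fun x hx => ?_
      rw [← aux_sub]
      rw [h𝓤] at hu
      exact aux_weak P ℱ hℱ_le hℱ_mono nt f0 fj hf0_meas hfj_meas H0 Hj y hym hy0 hLi
        (hconvL hy0) v' hv' x hx u (measurable_pi_lambda _ fun j => h𝓤₀meas _ (hu j))
        (hdotI (fun j ω => u ω j) hu)
    · have : intFconj P (fCon f0 fj) v' y = ⊤ := by
        unfold intFconj EE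
        rw [if_pos]
        rw [ae_all_iff] at hy0
        push Not at hy0
        obtain ⟨j₀, hj₀⟩ := hy0
        have hBm : MeasurableSet {ω | y ω j₀ < 0} :=
          measurableSet_lt (h𝓨₀meas _ (hyj j₀)) measurable_const
        have hPB : P {ω | y ω j₀ < 0} ≠ 0 := by
          intro h
          apply hj₀
          rw [ae_iff]
          simpa using h
        rw [eq_top_iff]
        calc (⊤ : ℝ≥0∞) = ∫⁻ ω, ({ω | y ω j₀ < 0} : Set Ω).indicator (fun _ => ⊤) ω ∂P := by
              rw [lintegral_indicator_const hBm, ENNReal.top_mul hPB]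
          _ ≤ _ := by
              refine lintegral_mono_ae ?_
              filter_upwards [H0, Hj] with ω h2 h3
              by_cases h : ω ∈ {ω | y ω j₀ < 0}
              · rw [aux_C f0 fj ω h2 h3 (v' ω) (y ω) j₀ h]
                simp [epos]
              · rw [Set.indicator_of_notMem h]
                exact bot_le
      rw [this]
      exact le_top
  have hex : ∃ v ∈ Nperp nt ℱ P, intFconj P (fCon f0 fj) v y ≤
      conj P 𝓤 (valueFnInf P (fCon f0 fj) ℱ) y := by
    by_cases hT : conj P 𝓤 (valueFnInf P (fCon f0 fj) ℱ) y = ⊤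
    · refine ⟨fun _ => 0, ⟨measurable_const, integrable_const _, fun x _ => ?_⟩, by
        rw [hT]; exact le_top⟩
      simp [dotN]
    have hy0 : ∀ᵐ ω ∂P, ∀ j, 0 ≤ y ω j := by
      by_contra h
      exact hT (htop h)
    have hbd : ∀ x ∈ NspaceInf nt ℱ P, ((- ∫ ω, L (x ω) ω ∂P : ℝ) : EReal) ≤
        conj P 𝓤 (valueFnInf P (fCon f0 fj) ℱ) y := by
      intro x hx
      obtain ⟨g0, hg0, g, hg, h0, h1, he⟩ := hLg _ hx
      have huU : (fun ω j => - g j ω) ∈ 𝓤 := by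
        rw [h𝓤]
        intro j
        simpa using hneg _ (hg j) 0 _ hzero𝓤
      have := hlow x hx g0 hg0 h0 _ huU (by
        filter_upwards [h1] with ω hω j
        rw [hω j, ← EReal.coe_add]
        simp)
      convert this using 2
      rw [integral_congr_ae he, integral_add (hUint _ hg0) (hdotI g hg)]
      have e : pairing P (fun ω j => - g j ω) y = - ∫ ω, ∑ j, g j ω * y ω j ∂P := by
        unfold pairing
        rw [← integral_neg]
        simp [dotM]
      rw [e]; ring
    have hB : conj P 𝓤 (valueFnInf P (fCon f0 fj) ℱ) y ≠ ⊥ := by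
      intro h
      have := hbd _ (hconst 0)
      rw [h] at this
      simp at this
    obtain ⟨β, hβ⟩ : ∃ β : ℝ, conj P 𝓤 (valueFnInf P (fCon f0 fj) ℱ) y = (β : EReal) :=
      ⟨_, (EReal.coe_toReal hT hB).symm⟩
    obtain ⟨v, hv, G, hGi, hGC, hG⟩ := aux_core P ℱ hℱ_le nt L hLm hLi (hconvL hy0) (-β) (by
      intro s hs
      obtain ⟨C, hC⟩ := s.exists_forall_norm_le
      have := hbd s ⟨hs, C, Filter.Eventually.of_forall hC⟩
      rw [hβ, EReal.coe_le_coe_iff] at this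
      linarith)
    refine ⟨v, hv, ?_⟩
    rw [hβ]
    calc intFconj P (fCon f0 fj) v y ≤ EE P (fun ω => ((G ω : ℝ) : EReal)) := by
          refine EE_mono ?_
          filter_upwards [hG, H0, Hj, hy0] with ω a1 a2 a3 a4
          refine iSup₂_le fun a b => (aux_A f0 fj ω a2 a3 _ _ a4 a b).trans ?_
          rw [EReal.coe_le_coe_iff]
          exact a1 a
      _ = ((∫ ω, G ω ∂P : ℝ) : EReal) := EE_coe hGi
      _ ≤ (β : EReal) := by
          rw [EReal.coe_le_coe_iff]; linarith
  obtain ⟨v, hv, hle⟩ := hex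
  have hw := hweak v hv
  refine ⟨v, hv, le_antisymm hle (hmono.trans hw), le_antisymm (hw.trans hle) hmono,
    le_antisymm hw (hle.trans hmono), fun v' hv' => (hle.trans hmono).trans (hweak v' hv')⟩
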